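/- arXiv:1911.10399 — 2 statements merged into one kernel-verified Lean document; each statement's English description precedes it below -/
import Mathlib

section
/- Let (B(x_j,r_j))_{j=1}^∞ be balls in 𝕋^d with r_j → 0 such that limsup_{j→∞} B(x_j,r_j) has full Lebesgue measure, and suppose that the sets U_j ⊂ B(x_j,r_j) are open ellipsoids. Set s = sup{ t : sup_j λ(B(x_j,r_j))/φ^t(U_j) < ∞ }. Then dim_H limsup_{j→∞} U_j ≥ s and limsup_{j→∞} U_j ∈ 𝒢^s(𝕋^d). -/
open MeasureTheory Metric Filter Set
open scoped ENNReal Topology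

noncomputable section

/-- The `d`-dimensional torus `ℝ^d / ℤ^d`. -/
abbrev Torus (d : ℕ) := Fin d → AddCircle (1 : ℝ)

/-- The canonical projection `ℝ^d → 𝕋^d`. -/
def torusProj {d : ℕ} (y : Fin d → ℝ) : Torus d := fun i => (y i : AddCircle (1 : ℝ))

/-- A dyadic cube in the torus: the image under the projection `ℝ^d → 𝕋^d` of a product
of intervals `[kᵢ 2^{-n}, (kᵢ+1) 2^{-n})`. -/
def IsDyadicCube {d : ℕ} (D : Set (Torus d)) : Prop :=
  ∃ (n : ℕ) (k : Fin d → ℤ),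
    D = torusProj ''
      (Set.univ.pi fun i => Set.Ico ((k i : ℝ) / 2 ^ n) (((k i : ℝ) + 1) / 2 ^ n))

/-- The outer dyadic content `ℳ_∞^t(E) = inf { Σ_k |D_k|^t : E ⊆ ⋃_k D_k, D_k dyadic }`. -/
noncomputable def dyadicContent {d : ℕ} (t : ℝ) (E : Set (Torus d)) : ℝ≥0∞ :=
  ⨅ (f : ℕ → Set (Torus d)) (_ : ∀ n, IsDyadicCube (f n)) (_ : E ⊆ ⋃ n, f n),
    ∑' n, EMetric.diam (f n) ^ t

/-- Falconer's class `𝒢^s(𝕋^d)` of sets with large intersections: `G_δ` sets `E` with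
`ℳ_∞^t(E ∩ D) ≥ |D|^t` for all dyadic cubes `D` and all `t < s`. -/
def MemLargeIntersectionClass {d : ℕ} (s : ℝ) (E : Set (Torus d)) : Prop :=
  IsGδ E ∧ ∀ D : Set (Torus d), IsDyadicCube D → ∀ t : ℝ, t < s →
    EMetric.diam D ^ t ≤ dyadicContent t (E ∩ D)

/-- The generalised singular value function `φ^t` of a tuple of semi-axes (or side
lengths) `a₁ ≥ a₂ ≥ … ≥ a_d`: for `m < t ≤ m + 1`,
`φ^t(a) = a₁ ⋯ a_m · a_{m+1}^{t-m}`. -/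
noncomputable def singularValueFunction {d : ℕ} (a : Fin d → ℝ) (t : ℝ) : ℝ :=
  (∏ i ∈ Finset.univ.filter (fun i : Fin d => (i : ℕ) < ⌈t⌉₊ - 1), a i) *
    (if h : ⌈t⌉₊ - 1 < d then a ⟨⌈t⌉₊ - 1, h⟩ else 1) ^ (t - (⌈t⌉₊ - 1 : ℕ))

/-- `U ⊆ 𝕋^d` is an (open) ellipsoid with semi-axes `a 0 ≥ a 1 ≥ … ≥ a (d-1) > 0`: it is
the image under the projection `ℝ^d → 𝕋^d` of a Euclidean ellipsoid of diameter `< 1`. -/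
def IsEllipsoidWithSemiaxes {d : ℕ} (U : Set (Torus d)) (a : Fin d → ℝ) : Prop :=
  (∀ i, 0 < a i) ∧ (∀ i j : Fin d, i ≤ j → a j ≤ a i) ∧
  ∃ (c : Fin d → ℝ) (v : Fin d → Fin d → ℝ),
    (∀ i j : Fin d, ∑ l, v i l * v j l = if i = j then 1 else 0) ∧
    Metric.diam {y : Fin d → ℝ | ∑ i, ((∑ l, (y l - c l) * v i l) / a i) ^ 2 < 1} < 1 ∧
    U = torusProj '' {y : Fin d → ℝ | ∑ i, ((∑ l, (y l - c l) * v i l) / a i) ^ 2 < 1}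

namespace MassTransference

section Tree

variable {X K : Type*} {q : ℕ → X → K} {g : ℕ → ℝ≥0∞} {C M : Set (ℕ × K)} {p c m : ℕ × K}

/-- The level-`p.1` cell with label `p.2` of the partitions given by the labellings `q n`. -/
def cell (q : ℕ → X → K) (p : ℕ × K) : Set X := {x | q p.1 x = p.2}

/-- Each partition refines the previous one. -/
def Refining (q : ℕ → X → K) : Prop := ∀ n x y, q (n + 1) x = q (n + 1) y → q n x = q n y

/-- The total weight of the cells of `C` that meet `p`. -/
def cellMass (q : ℕ → X → K) (g : ℕ → ℝ≥0∞) (C : Set (ℕ × K)) (p : ℕ × K) : ℝ≥0∞ :=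
  ∑' c, {c | c ∈ C ∧ (cell q c ∩ cell q p).Nonempty}.indicator (fun c => g c.1) c

/-- Every cell of `M` that meets `p` is of strictly higher level. -/
def IsFree (q : ℕ → X → K) (M : Set (ℕ × K)) (p : ℕ × K) : Prop :=
  ∀ m ∈ M, (cell q m ∩ cell q p).Nonempty → p.1 < m.1

lemma Refining.eq_of_le (hq : Refining q) {n k : ℕ} (h : n ≤ k) {x y : X} (hxy : q k x = q k y) :
    q n x = q n y := by
  induction k, h using Nat.le_induction with
  | base => exact hxy
  | succ k _ ih => exact ih (hq k x y hxy)

lemma Refining.cell_subset (hq : Refining q) (h : p.1 ≤ c.1) (hne : (cell q c ∩ cell q p).Nonempty) :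
    cell q c ⊆ cell q p := by
  obtain ⟨x, hxc, hxp⟩ := hne
  intro y hy
  exact (hq.eq_of_le h (hy.trans hxc.symm)).trans hxp

lemma eq_of_mem_cell {x : X} (hc : x ∈ cell q c) (hm : x ∈ cell q m) (h : c.1 = m.1) : c = m := by
  refine Prod.ext h ?_
  rw [← hc, ← hm, h]

lemma le_cellMass (hc : c ∈ C) (hne : (cell q c ∩ cell q p).Nonempty) :
    g c.1 ≤ cellMass q g C p := by
  refine le_trans ?_ (ENNReal.le_tsum c)
  rw [Set.indicator_of_mem]
  exact ⟨hc, hne⟩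

lemma cellMass_le_tsum : cellMass q g C p ≤ ∑' c, C.indicator (fun c => g c.1) c :=
  ENNReal.tsum_le_tsum fun _ => Set.indicator_le_indicator_of_subset (fun _ h => h.1)
    (fun _ => zero_le) _

/-- The sum over `A` of the masses of a family of cells is at most the mass of `p`, provided that
each cell of `C` meets at most one of them. -/
lemma tsum_cellMass_le {A : Set (ℕ × K)}
    (hsub : ∀ m ∈ A, ∀ c ∈ C, (cell q c ∩ cell q m).Nonempty → (cell q c ∩ cell q p).Nonempty)
    (huniq : ∀ m ∈ A, ∀ m' ∈ A, ∀ c ∈ C, (cell q c ∩ cell q m).Nonempty →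
      (cell q c ∩ cell q m').Nonempty → m = m') :
    ∑' m, A.indicator (cellMass q g C) m ≤ cellMass q g C p := by
  classical
  have h1 : ∀ m, A.indicator (cellMass q g C) m = ∑' c, if m ∈ A ∧ c ∈ C ∧
      (cell q c ∩ cell q m).Nonempty then g c.1 else 0 := by
    intro m
    by_cases hm : m ∈ A
    · simp [hm, cellMass, Set.indicator_apply]
    · simp [hm]
  simp_rw [h1]
  rw [ENNReal.tsum_comm]
  refine ENNReal.tsum_le_tsum fun c => ?_
  by_cases h : ∃ m, m ∈ A ∧ c ∈ C ∧ (cell q c ∩ cell q m).Nonempty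
  · obtain ⟨m, hm, hc, hne⟩ := h
    rw [tsum_eq_single m]
    · rw [if_pos ⟨hm, hc, hne⟩, Set.indicator_of_mem]
      exact ⟨hc, hsub m hm c hc hne⟩
    · intro m' hm'
      rw [if_neg]
      rintro ⟨h1, -, h3⟩
      exact hm' (huniq m' h1 m hm c hc h3 hne)
  · push Not at h
    rw [ENNReal.tsum_eq_zero.2]
    · exact zero_le
    · intro m
      rw [if_neg]
      rintro ⟨h1, h2, h3⟩
      exact (h3.ne_empty) (h m h1 h2)

/-- A family of cells of small mass in `p` may be enlarged to a family of maximal cells. -/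
lemma Refining.exists_maximal_family (hq : Refining q) (hg : Antitone g)
    (hC : cellMass q g C p < g p.1) :
    ∃ M : Set (ℕ × K), (∀ x ∈ cell q p, (∃ c ∈ C, x ∈ cell q c) → ∃ m ∈ M, x ∈ cell q m) ∧
      IsFree q M p ∧ ∀ c, (cell q c).Nonempty → p.1 ≤ c.1 → cell q c ⊆ cell q p → IsFree q M c →
        cellMass q g M c < g c.1 := by
  set M : Set (ℕ × K) := {m | p.1 ≤ m.1 ∧ (cell q m ∩ cell q p).Nonempty ∧
    g m.1 ≤ cellMass q g C m ∧ ∀ n, p.1 ≤ n → n < m.1 → ∀ x ∈ cell q m,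
      cellMass q g C (n, q n x) < g n} with hM
  have hself : ∀ n x, x ∈ cell q (n, q n x) := fun n x => rfl
  have hmem : ∀ {c : ℕ × K} {x}, x ∈ cell q c → c = (c.1, q c.1 x) :=
    fun {c x} hx => eq_of_mem_cell hx (hself _ _) rfl
  have exM : ∀ x ∈ cell q p, ∀ n, p.1 ≤ n → g n ≤ cellMass q g C (n, q n x) →
      ∃ m ∈ M, x ∈ cell q m ∧ m.1 ≤ n := by
    classical
    intro x hx n hn hbad
    have hex : ∃ n, p.1 ≤ n ∧ g n ≤ cellMass q g C (n, q n x) := ⟨n, hn, hbad⟩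
    refine ⟨(Nat.find hex, q (Nat.find hex) x), ⟨(Nat.find_spec hex).1, ⟨x, hself _ _, hx⟩,
      (Nat.find_spec hex).2, ?_⟩, hself _ _, Nat.find_le ⟨hn, hbad⟩⟩
    intro k hk hlt y hy
    have := Nat.find_min hex hlt
    push Not at this
    rw [hq.eq_of_le hlt.le (x := y) (y := x) hy]
    exact this hk
  have hlev : ∀ c ∈ C, (cell q c ∩ cell q p).Nonempty → p.1 ≤ c.1 := by
    intro c hc hne
    by_contra! hlt
    exact absurd ((hg hlt.le).trans (le_cellMass hc hne)) hC.not_ge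
  refine ⟨M, ?_, ?_, ?_⟩
  · rintro x hx ⟨c, hc, hxc⟩
    have : g c.1 ≤ cellMass q g C (c.1, q c.1 x) := by
      rw [← hmem hxc]; exact le_cellMass hc ⟨x, hxc, hxc⟩
    obtain ⟨m, hm, hxm, -⟩ := exM x hx c.1 (hlev c hc ⟨x, hxc, hx⟩) this
    exact ⟨m, hm, hxm⟩
  · rintro m ⟨h1, -, h3, -⟩ ⟨x, hxm, hxp⟩
    by_contra! hle
    have := eq_of_mem_cell hxm hxp (le_antisymm hle h1)
    rw [this] at h3
    exact absurd h3 hC.not_ge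
  · rintro c ⟨x, hxc⟩ hpc hcp hfree
    have hnb : cellMass q g C c < g c.1 := by
      by_contra! hb
      rw [hmem hxc] at hb
      obtain ⟨m, hm, hxm, hle⟩ := exM x (hcp hxc) c.1 hpc hb
      exact absurd (hfree m hm ⟨x, hxm, hxc⟩) hle.not_gt
    refine lt_of_le_of_lt ?_ hnb
    set A : Set (ℕ × K) := {m | m ∈ M ∧ (cell q m ∩ cell q c).Nonempty}
    have hAc : ∀ m ∈ A, cell q m ⊆ cell q c := fun m hm =>
      hq.cell_subset (hfree m hm.1 hm.2).le hm.2
    have hsubm : ∀ m ∈ A, ∀ c' ∈ C, (cell q c' ∩ cell q m).Nonempty → cell q c' ⊆ cell q m := by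
      rintro m hm c' hc' ⟨y, hyc, hym⟩
      refine hq.cell_subset ?_ ⟨y, hyc, hym⟩
      by_contra! hlt
      have := hm.1.2.2.2 c'.1 (hlev c' hc' ⟨y, hyc, hcp (hAc m hm hym)⟩) hlt y hym
      rw [← hmem hyc] at this
      exact absurd (le_cellMass hc' ⟨y, hyc, hyc⟩) this.not_ge
    have hmin : ∀ m ∈ M, ∀ m' ∈ M, ∀ y, y ∈ cell q m → y ∈ cell q m' → m'.1 ≤ m.1 := by
      intro m hm m' hm' y hy hy'
      by_contra! hlt
      have := hm'.2.2.2 m.1 hm.1 hlt y hy'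
      rw [← hmem hy] at this
      exact absurd hm.2.2.1 this.not_ge
    refine le_trans (ENNReal.tsum_le_tsum fun m => ?_)
      (tsum_cellMass_le (A := A) (p := c) (C := C) ?_ ?_)
    · exact Set.indicator_le_indicator' fun hm => hm.1.2.2.1
    · rintro m hm c' hc' ⟨y, hyc, hym⟩
      exact ⟨y, hyc, hAc m hm hym⟩
    · rintro m hm m' hm' c' hc' ⟨y, hyc, hym⟩ hne'
      have hym' := hsubm m' hm' c' hc' hne' hyc
      exact eq_of_mem_cell hym hym' (le_antisymm (hmin m' hm'.1 m hm.1 y hym' hym)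
        (hmin m hm.1 m' hm'.1 y hym hym'))

/-- Every nonempty cell has at least `N` nonempty children. -/
def Branching (q : ℕ → X → K) (N : ℕ) : Prop :=
  ∀ p, (cell q p).Nonempty → ∃ S : Finset K, S.card = N ∧
    ∀ k ∈ S, (cell q (p.1 + 1, k)).Nonempty ∧ cell q (p.1 + 1, k) ⊆ cell q p

/-- A free cell has a free child of relatively smaller mass. -/
lemma Refining.exists_free_child (hq : Refining q) {N : ℕ} (hN : Branching q N) {b : ℝ≥0∞}
    (hb : b < N) (hgb : ∀ n, g n ≤ b * g (n + 1)) (hg0 : ∀ n, g n ≠ 0) (hgt : ∀ n, g n ≠ ⊤)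
    (hp : (cell q p).Nonempty) (hfree : IsFree q M p) {θ : ℝ≥0∞} (hθ : θ ≤ 1)
    (hmass : cellMass q g M p ≤ θ * g p.1) :
    ∃ c, c.1 = p.1 + 1 ∧ (cell q c).Nonempty ∧ cell q c ⊆ cell q p ∧ IsFree q M c ∧
      cellMass q g M c ≤ (b / N * θ) * g c.1 := by
  classical
  obtain ⟨S, hS, hSp⟩ := hN p hp
  have hN0 : (N : ℝ≥0∞) ≠ 0 := (zero_le.trans_lt hb).ne'
  have hNt : (N : ℝ≥0∞) ≠ ⊤ := ENNReal.natCast_ne_top N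
  have hSne : S.Nonempty := by
    rw [← Finset.card_pos, hS]
    exact Nat.pos_of_ne_zero fun h => hN0 (by simp [h])
  obtain ⟨k, hk, hkmin⟩ := S.exists_min_image (fun k => cellMass q g M (p.1 + 1, k)) hSne
  have hsum : ∑ k ∈ S, cellMass q g M (p.1 + 1, k) ≤ cellMass q g M p := by
    have : ∑ k ∈ S, cellMass q g M (p.1 + 1, k) =
        ∑' m, (↑(S.image fun k => (p.1 + 1, k)) : Set (ℕ × K)).indicator (cellMass q g M) m := by
      rw [← tsum_subtype, Finset.tsum_subtype', Finset.sum_image]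
      intro a _ b _ h
      exact (Prod.ext_iff.1 h).2
    rw [this]
    refine tsum_cellMass_le ?_ ?_
    · intro m hm c hc hne
      simp only [Finset.coe_image, Set.mem_image, Finset.mem_coe] at hm
      obtain ⟨k, hk, rfl⟩ := hm
      obtain ⟨y, h1, h2⟩ := hne
      exact ⟨y, h1, (hSp k hk).2 h2⟩
    · intro m hm m' hm' c hc hne hne'
      simp only [Finset.coe_image, Set.mem_image, Finset.mem_coe] at hm hm'
      obtain ⟨k, hk, rfl⟩ := hm
      obtain ⟨k', hk', rfl⟩ := hm'
      obtain ⟨y, h1, h2⟩ := hne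
      have hlt := hfree c hc ⟨y, h1, (hSp k hk).2 h2⟩
      exact eq_of_mem_cell h2 (hq.cell_subset (p := (p.1 + 1, k')) hlt hne' h1) rfl
  have hkm : (N : ℝ≥0∞) * cellMass q g M (p.1 + 1, k) ≤ cellMass q g M p := by
    refine le_trans ?_ hsum
    rw [← hS, ← nsmul_eq_mul]
    exact Finset.card_nsmul_le_sum _ _ _ hkmin
  have hle : cellMass q g M (p.1 + 1, k) ≤ (b / N * θ) * g (p.1 + 1) := by
    have h1 : cellMass q g M (p.1 + 1, k) ≤ (θ * (b * g (p.1 + 1))) / N := by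
      rw [ENNReal.le_div_iff_mul_le (Or.inl hN0) (Or.inl hNt), mul_comm]
      exact hkm.trans (hmass.trans (by gcongr; exact hgb _))
    refine h1.trans (le_of_eq ?_)
    simp only [div_eq_mul_inv]
    ring
  have hbN : b / N < 1 := by
    rw [ENNReal.div_lt_iff (Or.inl hN0) (Or.inl hNt), one_mul]
    exact hb
  have hlt : cellMass q g M (p.1 + 1, k) < g (p.1 + 1) := by
    refine hle.trans_lt ?_
    calc b / N * θ * g (p.1 + 1) ≤ b / N * 1 * g (p.1 + 1) := by gcongr
      _ = b / N * g (p.1 + 1) := by rw [mul_one]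
      _ < 1 * g (p.1 + 1) := by
        rw [ENNReal.mul_lt_mul_iff_left (hg0 _) (hgt _)]; exact hbN
      _ = g (p.1 + 1) := one_mul _
  refine ⟨(p.1 + 1, k), rfl, (hSp k hk).1, (hSp k hk).2, ?_, hle⟩
  rintro m hm ⟨y, hym, hyk⟩
  have h1 := hfree m hm ⟨y, hym, (hSp k hk).2 hyk⟩
  by_contra! h2
  have h3 := le_cellMass (g := g) hm ⟨y, hym, hyk⟩
  rw [show m.1 = p.1 + 1 from le_antisymm h2 h1] at h3
  exact absurd h3 hlt.not_ge

lemma Refining.exists_free_subcell (hq : Refining q) {N : ℕ} (hN : Branching q N) {b : ℝ≥0∞}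
    (hb : b < N) (hgb : ∀ n, g n ≤ b * g (n + 1)) (hg0 : ∀ n, g n ≠ 0) (hgt : ∀ n, g n ≠ ⊤)
    (hp : (cell q p).Nonempty) (hfree : IsFree q M p) (hmass : cellMass q g M p ≤ g p.1)
    {ε : ℝ≥0∞} (hε : 0 < ε) :
    ∃ c, p.1 ≤ c.1 ∧ (cell q c).Nonempty ∧ cell q c ⊆ cell q p ∧ IsFree q M c ∧
      cellMass q g M c ≤ ε * g c.1 := by
  have hN0 : (N : ℝ≥0∞) ≠ 0 := (zero_le.trans_lt hb).ne'
  have hbN : b / N < 1 := by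
    rw [ENNReal.div_lt_iff (Or.inl hN0) (Or.inl (ENNReal.natCast_ne_top N)), one_mul]
    exact hb
  have key : ∀ k : ℕ, ∃ c, p.1 ≤ c.1 ∧ (cell q c).Nonempty ∧ cell q c ⊆ cell q p ∧
      IsFree q M c ∧ cellMass q g M c ≤ (b / N) ^ k * g c.1 := by
    intro k
    induction k with
    | zero => exact ⟨p, le_rfl, hp, subset_rfl, hfree, by simpa using hmass⟩
    | succ k ih =>
      obtain ⟨c, h1, h2, h3, h4, h5⟩ := ih
      obtain ⟨c', h1', h2', h3', h4', h5'⟩ := hq.exists_free_child hN hb hgb hg0 hgt h2 h4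
        (pow_le_one' hbN.le k) h5
      refine ⟨c', by omega, h2', h3'.trans h3, h4', ?_⟩
      rwa [pow_succ']
  have hlim := ENNReal.tendsto_pow_atTop_nhds_zero_of_lt_one hbN
  obtain ⟨k, hk⟩ := (hlim.eventually (gt_mem_nhds hε)).exists
  obtain ⟨c, h1, h2, h3, h4, h5⟩ := key k
  exact ⟨c, h1, h2, h3, h4, h5.trans (by gcongr)⟩

/-- If each `V n` is open and, inside every cell, cannot be covered by a family of cells of small
mass, then the content of `(⋂ n, V n) ∩ cell q p` is maximal for every cell. -/
theorem Refining.le_tsum_of_iInter_subset [MetricSpace X] [CompactSpace X] (hq : Refining q)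
    (hdist : ∀ n x y, q n x = q n y → dist x y ≤ (1 / 2) ^ n)
    {N : ℕ} (hN : Branching q N) {b : ℝ≥0∞} (hb : b < N) (hg : Antitone g)
    (hgb : ∀ n, g n ≤ b * g (n + 1)) (hg0 : ∀ n, g n ≠ 0) (hgt : ∀ n, g n ≠ ⊤)
    {V : ℕ → Set X} (hV : ∀ n, IsOpen (V n)) {ε : ℝ≥0∞} (hε : 0 < ε)
    (hcov : ∀ n p M, (cell q p).Nonempty → cellMass q g M p ≤ ε * g p.1 →
      ∃ x ∈ V n ∩ interior (cell q p), ∀ m ∈ M, x ∉ cell q m)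
    (hp : (cell q p).Nonempty) (hC : (⋂ n, V n) ∩ cell q p ⊆ ⋃ c ∈ C, cell q c) :
    g p.1 ≤ ∑' c, C.indicator (fun c => g c.1) c := by
  refine le_trans ?_ (cellMass_le_tsum (q := q) (p := p))
  by_contra! hlt
  obtain ⟨M, hMcov, hMp, hMfree⟩ := hq.exists_maximal_family hg hlt
  let Good : Type _ := {c : ℕ × K // (cell q c).Nonempty ∧ p.1 ≤ c.1 ∧ cell q c ⊆ cell q p ∧
    IsFree q M c}
  have step : ∀ (n : ℕ) (c : Good), ∃ c' : Good, c.1.1 < c'.1.1 ∧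
      closure (cell q c'.1) ⊆ V n ∩ cell q c.1 := by
    rintro n ⟨c, hne, hlev, hsub, hfree⟩
    obtain ⟨c₁, h1, h2, h3, h4, h5⟩ := hq.exists_free_subcell hN hb hgb hg0 hgt hne hfree
      (hMfree c hne hlev hsub hfree).le hε
    obtain ⟨x, hx, hxM⟩ := hcov n c₁ M h2 h5
    have hO : V n ∩ interior (cell q c₁) ∈ 𝓝 x := ((hV n).inter isOpen_interior).mem_nhds hx
    obtain ⟨δ, hδ, hball⟩ := Metric.nhds_basis_closedBall.mem_iff.1 hO
    obtain ⟨k, hk⟩ := exists_pow_lt_of_lt_one hδ (show (1 / 2 : ℝ) < 1 by norm_num)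
    set l := max k (c.1 + 1)
    have hlδ : (1 / 2 : ℝ) ^ l ≤ δ :=
      (pow_le_pow_of_le_one (by norm_num) (by norm_num) (le_max_left k (c.1 + 1))).trans hk.le
    have hcl : closure (cell q (l, q l x)) ⊆ V n ∩ interior (cell q c₁) := by
      refine subset_trans (closure_minimal ?_ isClosed_closedBall) hball
      intro y hy
      exact (hdist l y x hy).trans hlδ
    have hcl' : cell q (l, q l x) ⊆ cell q c₁ :=
      (subset_closure.trans hcl).trans (inter_subset_right.trans interior_subset)
    have hl : c.1 < l := lt_of_lt_of_le (Nat.lt_succ_self _) (le_max_right _ _)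
    refine ⟨⟨(l, q l x), ⟨x, rfl⟩, hlev.trans hl.le, (hcl'.trans h3).trans hsub, ?_⟩, hl, ?_⟩
    · rintro m hm ⟨y, hym, hyl⟩
      by_contra! hle
      exact hxM m hm ((hq.eq_of_le hle (x := x) (y := y) hyl.symm).trans hym)
    · exact hcl.trans (inter_subset_inter_right _ (interior_subset.trans h3))
  choose next hnext_lt hnext_sub using step
  let f : ℕ → Good := fun n =>
    Nat.rec ⟨p, hp, le_rfl, subset_rfl, hMp⟩ (fun n c => next n c) n
  have hf : ∀ n, f (n + 1) = next n (f n) := fun n => rfl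
  have hflev : ∀ n, n ≤ (f n).1.1 := by
    intro n
    induction n with
    | zero => exact Nat.zero_le _
    | succ n ih =>
      have := hnext_lt n (f n)
      rw [← hf] at this
      omega
  have hfsub : ∀ n, closure (cell q (f (n + 1)).1) ⊆ V n ∩ cell q (f n).1 := by
    intro n
    rw [hf]
    exact hnext_sub n (f n)
  obtain ⟨x, hx⟩ := IsCompact.nonempty_iInter_of_sequence_nonempty_isCompact_isClosed
    (fun n => closure (cell q (f n).1))
    (fun n => (hfsub n).trans (inter_subset_right.trans subset_closure))
    (fun n => (f n).2.1.closure) isClosed_closure.isCompact (fun n => isClosed_closure)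
  rw [mem_iInter] at hx
  have hxp : x ∈ cell q p := (hfsub 0 (hx 1)).2
  have hxV : x ∈ ⋂ n, V n := mem_iInter.2 fun n => (hfsub n (hx (n + 1))).1
  have hxC := hC ⟨hxV, hxp⟩
  simp only [mem_iUnion, exists_prop] at hxC
  obtain ⟨m, hm, hxm⟩ := hMcov x hxp hxC
  have := (f m.1).2.2.2.2 m hm ⟨x, hxm, (hfsub m.1 (hx (m.1 + 1))).2⟩
  exact absurd (hflev m.1) this.not_ge

end Tree

section Grid

variable {d : ℕ}

/-- The representative in `[0, 1)` of a point of the circle. -/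
def rep (u : AddCircle (1 : ℝ)) : ℝ := AddCircle.equivIco 1 0 u

lemma coe_rep (u : AddCircle (1 : ℝ)) : ((rep u : ℝ) : AddCircle (1 : ℝ)) = u :=
  AddCircle.coe_equivIco

lemma rep_coe (y : ℝ) : rep (y : AddCircle (1 : ℝ)) = Int.fract y := by
  simp [rep]

lemma rep_nonneg (u : AddCircle (1 : ℝ)) : 0 ≤ rep u := (AddCircle.equivIco 1 0 u).2.1

lemma rep_lt_one (u : AddCircle (1 : ℝ)) : rep u < 1 := by
  simpa [rep] using (AddCircle.equivIco (1 : ℝ) 0 u).2.2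

lemma exists_coe_eq_abs_eq_norm (u : AddCircle (1 : ℝ)) :
    ∃ δ : ℝ, (δ : AddCircle (1 : ℝ)) = u ∧ |δ| = ‖u‖ := by
  refine ⟨rep u - round (rep u), ?_, ?_⟩
  · rw [AddCircle.coe_sub, coe_rep, sub_eq_self, AddCircle.coe_eq_zero_iff]
    exact ⟨round (rep u), by simp⟩
  · conv_rhs => rw [← coe_rep u]
    exact (UnitAddCircle.norm_eq).symm

lemma norm_coe_le_abs (y : ℝ) : ‖(y : AddCircle (1 : ℝ))‖ ≤ |y| := by
  rw [UnitAddCircle.norm_eq]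
  simpa using round_le y 0

/-- The label of the level-`n` dyadic cube containing a point of the torus. -/
def gridLabel (n : ℕ) (x : Torus d) : Fin d → ℤ := fun i => ⌊2 ^ n * rep (x i)⌋

lemma gridLabel_nonneg (n : ℕ) (x : Torus d) (i : Fin d) : 0 ≤ gridLabel n x i :=
  Int.floor_nonneg.2 (mul_nonneg (by positivity) (rep_nonneg _))

lemma gridLabel_lt (n : ℕ) (x : Torus d) (i : Fin d) : gridLabel n x i < 2 ^ n := by
  rw [gridLabel, Int.floor_lt]
  push_cast
  have := rep_lt_one (x i)
  have h2 : (0 : ℝ) < 2 ^ n := by positivity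
  nlinarith

lemma gridLabel_torusProj (n : ℕ) (y : Fin d → ℝ) (i : Fin d) :
    gridLabel n (torusProj y) i = ⌊2 ^ n * y i⌋ % 2 ^ n := by
  have h1 : gridLabel n (torusProj y) i = ⌊2 ^ n * y i⌋ - 2 ^ n * ⌊y i⌋ := by
    rw [gridLabel, torusProj, rep_coe, Int.fract, mul_sub]
    have : (2 : ℝ) ^ n * (⌊y i⌋ : ℝ) = ((2 ^ n * ⌊y i⌋ : ℤ) : ℝ) := by push_cast; rfl
    rw [this, Int.floor_sub_intCast]
  have h2 := gridLabel_nonneg n (torusProj y) i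
  have h3 := gridLabel_lt n (torusProj y) i
  rw [← Int.emod_eq_of_lt h2 h3, h1, Int.sub_mul_emod_self_left]

lemma gridLabel_succ_div (n : ℕ) (x : Torus d) (i : Fin d) :
    gridLabel (n + 1) x i / 2 = gridLabel n x i := by
  have := Int.floor_div_natCast (2 ^ (n + 1) * rep (x i)) 2
  rw [gridLabel, gridLabel]
  norm_num at this
  rw [← this]
  congr 1
  ring

lemma refining_gridLabel : Refining (gridLabel (d := d)) := by
  intro n x y h
  funext i
  rw [← gridLabel_succ_div n x, ← gridLabel_succ_div n y, h]

lemma dist_le_of_gridLabel_eq (n : ℕ) (x y : Torus d) (h : gridLabel n x = gridLabel n y) :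
    dist x y ≤ (1 / 2) ^ n := by
  refine (dist_pi_le_iff (by positivity)).2 fun i => ?_
  have hi := Int.abs_sub_lt_one_of_floor_eq_floor (congrFun h i)
  rw [dist_eq_norm, ← coe_rep (x i), ← coe_rep (y i), ← AddCircle.coe_sub]
  refine (norm_coe_le_abs _).trans ?_
  rw [← mul_sub, abs_mul, abs_of_pos (by positivity : (0 : ℝ) < 2 ^ n)] at hi
  rw [one_div, inv_pow, ← one_div, le_div_iff₀ (by positivity), mul_comm]
  exact hi.le

lemma gridLabel_torusProj_of_floor_eq {n : ℕ} {y : Fin d → ℝ} {k : Fin d → ℤ}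
    (h : ∀ i, ⌊2 ^ n * y i⌋ = k i) (h0 : ∀ i, 0 ≤ k i) (h1 : ∀ i, k i < 2 ^ n) :
    torusProj y ∈ cell gridLabel (n, k) := by
  funext i
  rw [gridLabel_torusProj, h, Int.emod_eq_of_lt (h0 i) (h1 i)]

lemma label_bounds {p : ℕ × (Fin d → ℤ)} (hp : (cell gridLabel p).Nonempty) (i : Fin d) :
    0 ≤ p.2 i ∧ p.2 i < 2 ^ p.1 := by
  obtain ⟨x, hx⟩ := hp
  rw [← show gridLabel p.1 x = p.2 from hx]
  exact ⟨gridLabel_nonneg _ _ _, gridLabel_lt _ _ _⟩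

lemma branching_gridLabel : Branching (gridLabel (d := d)) (2 ^ d) := by
  intro p hp
  refine ⟨Fintype.piFinset fun i => {2 * p.2 i, 2 * p.2 i + 1}, ?_, ?_⟩
  · rw [Fintype.card_piFinset]
    have : ∀ i, ({2 * p.2 i, 2 * p.2 i + 1} : Finset ℤ).card = 2 := fun i =>
      Finset.card_pair (by omega)
    simp [this]
  · intro k hk
    rw [Fintype.mem_piFinset] at hk
    have hk' : ∀ i, k i = 2 * p.2 i ∨ k i = 2 * p.2 i + 1 := fun i => by simpa using hk i
    constructor
    · refine ⟨torusProj fun i => k i / 2 ^ (p.1 + 1), gridLabel_torusProj_of_floor_eq ?_ ?_ ?_⟩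
      · intro i
        rw [mul_div_cancel₀ _ (by positivity), Int.floor_intCast]
      · intro i
        have := (label_bounds hp i).1
        rcases hk' i with h | h <;> omega
      · intro i
        have := (label_bounds hp i).2
        rw [pow_succ]
        rcases hk' i with h | h <;> omega
    · intro x hx
      funext i
      have hx' : gridLabel (p.1 + 1) x i = k i := congrFun hx i
      rw [← gridLabel_succ_div, hx']
      rcases hk' i with h | h <;> omega

lemma exists_ball_subset_cell {p : ℕ × (Fin d → ℤ)} (hp : (cell gridLabel p).Nonempty) :
    ∃ z, ball z ((1 / 2) ^ p.1 / 2) ⊆ cell gridLabel p := by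
  refine ⟨torusProj fun i => (p.2 i + 1 / 2) / 2 ^ p.1, fun w hw => ?_⟩
  have h2 : (0 : ℝ) < 2 ^ p.1 := by positivity
  choose δ hδ hδ' using fun i => exists_coe_eq_abs_eq_norm
    (w i - torusProj (fun i => ((p.2 i : ℝ) + 1 / 2) / 2 ^ p.1) i)
  have hw' : w = torusProj fun i => ((p.2 i : ℝ) + 1 / 2) / 2 ^ p.1 + δ i := by
    funext i
    rw [torusProj, AddCircle.coe_add, hδ, torusProj, add_sub_cancel]
  rw [hw']
  refine gridLabel_torusProj_of_floor_eq (fun i => ?_) (fun i => (label_bounds hp i).1)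
    (fun i => (label_bounds hp i).2)
  have hi : |δ i| < (1 / 2) ^ p.1 / 2 := by
    rw [hδ', ← dist_eq_norm]
    exact (dist_le_pi_dist _ _ i).trans_lt hw
  rw [one_div, inv_pow, inv_eq_one_div, div_div, lt_div_iff₀ (by positivity)] at hi
  rw [mul_add, mul_div_cancel₀ _ h2.ne', Int.floor_eq_iff]
  have := abs_lt.1 (show |2 ^ p.1 * δ i| < 1 / 2 by
    rw [abs_mul, abs_of_pos h2]; linarith)
  constructor <;> linarith [this.1, this.2]

/-- A set of diameter at most `2⁻ⁿ` is covered by `3 ^ d` cells of level `n`. -/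
lemma exists_label_family (n : ℕ) (x : Torus d) :
    ∃ κ : (Fin d → Fin 3) → (Fin d → ℤ), ∀ y, dist y x ≤ (1 / 2) ^ n →
      ∃ e, y ∈ cell gridLabel (n, κ e) := by
  refine ⟨fun e i => (⌊2 ^ n * rep (x i)⌋ + ((e i : ℕ) : ℤ) - 1) % 2 ^ n, fun y hy => ?_⟩
  have h2 : (0 : ℝ) < 2 ^ n := by positivity
  choose δ hδ hδ' using fun i => exists_coe_eq_abs_eq_norm (y i - x i)
  have hy' : y = torusProj fun i => rep (x i) + δ i := by
    funext i
    rw [torusProj, AddCircle.coe_add, hδ, coe_rep, add_sub_cancel]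
  have key : ∀ i, ∃ e : Fin 3, ⌊2 ^ n * (rep (x i) + δ i)⌋ =
      ⌊2 ^ n * rep (x i)⌋ + ((e : ℕ) : ℤ) - 1 := by
    intro i
    have hi : |δ i| ≤ (1 / 2) ^ n := by
      rw [hδ', ← dist_eq_norm]
      exact (dist_le_pi_dist _ _ i).trans hy
    rw [one_div, inv_pow, inv_eq_one_div, le_div_iff₀ h2] at hi
    have hb := abs_le.1 (show |2 ^ n * δ i| ≤ 1 by rw [abs_mul, abs_of_pos h2]; linarith)
    rw [mul_add]
    set A := 2 ^ n * rep (x i)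
    set B := 2 ^ n * δ i
    have h1 : ⌊A⌋ - 1 ≤ ⌊A + B⌋ := by
      rw [Int.le_floor]; push_cast; linarith [Int.floor_le A]
    have h3 : ⌊A + B⌋ < ⌊A⌋ + 2 := by
      rw [Int.floor_lt]; push_cast; linarith [Int.lt_floor_add_one A]
    refine ⟨⟨(⌊A + B⌋ - ⌊A⌋ + 1).toNat, by omega⟩, ?_⟩
    simp only
    omega
  choose e he using key
  refine ⟨e, ?_⟩
  rw [hy']
  funext i
  rw [gridLabel_torusProj, he]

lemma IsDyadicCube.exists_cell {D : Set (Torus d)} (hD : IsDyadicCube D) :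
    ∃ p : ℕ × (Fin d → ℤ), D = cell gridLabel p ∧ (cell gridLabel p).Nonempty := by
  obtain ⟨n, k, rfl⟩ := hD
  have h2 : (0 : ℝ) < 2 ^ n := by positivity
  have hmem : ∀ y : Fin d → ℝ, (∀ i, ⌊2 ^ n * y i⌋ = k i) →
      torusProj y ∈ cell gridLabel (n, fun i => k i % 2 ^ n) := by
    intro y hy
    funext i
    rw [gridLabel_torusProj, hy]
  refine ⟨(n, fun i => k i % 2 ^ n), Subset.antisymm ?_ ?_,
    ⟨torusProj fun i => k i / 2 ^ n, hmem _ fun i => ?_⟩⟩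
  · rintro _ ⟨y, hy, rfl⟩
    refine hmem y fun i => ?_
    have := hy i (mem_univ i)
    rw [Set.mem_Ico, div_le_iff₀ h2, lt_div_iff₀ h2] at this
    rw [Int.floor_eq_iff]
    constructor <;> linarith [this.1, this.2]
  · intro x hx
    refine ⟨fun i => rep (x i) + (k i / 2 ^ n : ℤ), fun i _ => ?_, ?_⟩
    · have hxi : ⌊2 ^ n * rep (x i)⌋ = k i % 2 ^ n := congrFun hx i
      rw [Int.floor_eq_iff] at hxi
      have hdiv : ((k i % 2 ^ n : ℤ) : ℝ) + 2 ^ n * ((k i / 2 ^ n : ℤ) : ℝ) = k i := by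
        exact_mod_cast Int.emod_add_mul_ediv (k i) (2 ^ n)
      rw [Set.mem_Ico, div_le_iff₀ h2, lt_div_iff₀ h2]
      constructor <;> nlinarith [hxi.1, hxi.2]
    · funext i
      have : ((((k i / 2 ^ n : ℤ) : ℝ)) : AddCircle (1 : ℝ)) = 0 :=
        (AddCircle.coe_eq_zero_iff _).2 ⟨k i / 2 ^ n, by simp⟩
      rw [torusProj, AddCircle.coe_add, coe_rep, this, add_zero]
  · rw [mul_div_cancel₀ _ h2.ne', Int.floor_intCast]

lemma ediam_cell_le (p : ℕ × (Fin d → ℤ)) :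
    ediam (cell gridLabel p) ≤ ENNReal.ofReal ((1 / 2) ^ max p.1 1) := by
  refine ediam_le fun x hx y hy => ?_
  rw [edist_dist]
  refine ENNReal.ofReal_le_ofReal ?_
  rcases max_choice p.1 1 with h | h <;> rw [h]
  · exact dist_le_of_gridLabel_eq _ _ _ (Eq.trans hx hy.symm)
  · refine (dist_pi_le_iff (by positivity)).2 fun i => ?_
    rw [dist_eq_norm, pow_one]
    simpa using AddCircle.norm_le_half_period (1 : ℝ) (x := x i - y i) one_ne_zero

lemma le_ediam_cell (hd : 0 < d) {p : ℕ × (Fin d → ℤ)} (hp : (cell gridLabel p).Nonempty) :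
    ENNReal.ofReal ((1 / 2) ^ max p.1 1) ≤ ediam (cell gridLabel p) := by
  have h2 : (0 : ℝ) < 2 ^ p.1 := by positivity
  refine le_of_forall_lt fun h hh => ?_
  obtain ⟨h', hh', hlt⟩ := exists_between hh
  refine hh'.trans_le ?_
  lift h' to NNReal using hlt.ne_top
  have hlt' : (h' : ℝ) < (1 / 2) ^ max p.1 1 := by
    rw [← ENNReal.ofReal_coe_nnreal, ENNReal.ofReal_lt_ofReal_iff (by positivity)] at hlt
    exact hlt
  have hhalf : (h' : ℝ) ≤ 1 / 2 := hlt'.le.trans (by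
    simpa using pow_le_pow_of_le_one (by norm_num : (0 : ℝ) ≤ 1 / 2) (by norm_num)
      (le_max_right p.1 1))
  have hpn : 2 ^ p.1 * (h' : ℝ) < 1 := by
    have := hlt'.trans_le (pow_le_pow_of_le_one (by norm_num : (0 : ℝ) ≤ 1 / 2) (by norm_num)
      (le_max_left p.1 1))
    rw [one_div, inv_pow, inv_eq_one_div, lt_div_iff₀ h2] at this
    linarith
  have hmem : ∀ s : ℝ, 0 ≤ s → s ≤ h' →
      torusProj (fun i => p.2 i / 2 ^ p.1 + s) ∈ cell gridLabel p := by
    intro s hs0 hs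
    refine gridLabel_torusProj_of_floor_eq (fun i => ?_) (fun i => (label_bounds hp i).1)
      (fun i => (label_bounds hp i).2)
    rw [mul_add, mul_div_cancel₀ _ h2.ne', Int.floor_eq_iff]
    constructor <;> nlinarith
  refine le_trans ?_ (edist_le_ediam_of_mem (hmem h' h'.2 le_rfl) (hmem 0 le_rfl h'.2))
  refine le_trans ?_ (edist_le_pi_edist _ _ ⟨0, hd⟩)
  rw [edist_dist, dist_eq_norm, torusProj, torusProj, ← AddCircle.coe_sub, add_sub_add_left_eq_sub,
    sub_zero, (AddCircle.norm_coe_eq_abs_iff 1 one_ne_zero).2 (by simpa using hhalf)]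
  simp

end Grid

section Ellipsoid

variable {d : ℕ} {a : Fin d → ℝ} {t : ℝ}

lemma singularValueFunction_pos (ha : ∀ i, 0 < a i) : 0 < singularValueFunction a t := by
  refine mul_pos (Finset.prod_pos fun i _ => ha i) (Real.rpow_pos_of_pos ?_ _)
  split_ifs with h
  · exact ha _
  · exact one_pos

lemma rpow_mul_min_le {σ α θ : ℝ} (hσ : 0 < σ) (hα : 0 < α) (h0 : 0 ≤ θ) (h1 : θ ≤ 1) :
    α ^ θ * min σ α ≤ σ ^ θ * α := by
  rcases le_total σ α with h | h
  · rw [min_eq_left h]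
    have h2 : σ ^ (1 - θ) ≤ α ^ (1 - θ) := Real.rpow_le_rpow hσ.le h (by linarith)
    calc α ^ θ * σ = α ^ θ * (σ ^ θ * σ ^ (1 - θ)) := by
          rw [← Real.rpow_add hσ, add_sub_cancel, Real.rpow_one]
      _ ≤ α ^ θ * (σ ^ θ * α ^ (1 - θ)) := by gcongr
      _ = σ ^ θ * (α ^ θ * α ^ (1 - θ)) := by ring
      _ = σ ^ θ * α := by rw [← Real.rpow_add hα, add_sub_cancel, Real.rpow_one]
  · rw [min_eq_right h]
    gcongr

/-- A box of side `σ` meets a box with sides `a` in a proportion at most `σ ^ t / φ^t(a)`. -/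
lemma singularValueFunction_mul_prod_min_le (ha : ∀ i, 0 < a i) (ht0 : 0 < t) (htd : t ≤ d)
    {σ : ℝ} (hσ : 0 < σ) :
    singularValueFunction a t * ∏ i, min σ (a i) ≤ σ ^ t * ∏ i, a i := by
  have hc : ⌈t⌉₊ ≤ d := Nat.ceil_le.2 htd
  have hc0 : 0 < ⌈t⌉₊ := Nat.ceil_pos.2 ht0
  have hm : ⌈t⌉₊ - 1 < d := by omega
  have hcast : ((⌈t⌉₊ - 1 : ℕ) : ℝ) = ⌈t⌉₊ - 1 := by
    rw [Nat.cast_sub hc0, Nat.cast_one]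
  have hθ0 : 0 ≤ t - (⌈t⌉₊ - 1 : ℕ) := by
    rw [hcast]; linarith [Nat.ceil_lt_add_one ht0.le]
  have hθ1 : t - (⌈t⌉₊ - 1 : ℕ) ≤ 1 := by
    rw [hcast]; linarith [Nat.le_ceil t]
  rw [singularValueFunction, dif_pos hm]
  set m : Fin d := ⟨⌈t⌉₊ - 1, hm⟩ with hmdef
  set θ : ℝ := t - (⌈t⌉₊ - 1 : ℕ) with hθ
  have hfac : ∀ b : Fin d → ℝ,
      (∏ i ∈ Finset.univ.filter (fun i : Fin d => (i : ℕ) < ⌈t⌉₊ - 1), b i) * b m ^ θ =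
        ∏ i : Fin d, ((if (i : ℕ) < ⌈t⌉₊ - 1 then b i else 1) * if i = m then b i ^ θ else 1) := by
    intro b
    rw [Finset.prod_mul_distrib, Finset.prod_filter, Finset.prod_ite_eq' Finset.univ m]
    simp
  have hσt : σ ^ t = (∏ i ∈ Finset.univ.filter (fun i : Fin d => (i : ℕ) < ⌈t⌉₊ - 1), σ) * σ ^ θ := by
    rw [Finset.prod_const, Fin.card_filter_val_lt, min_eq_right hm.le, ← Real.rpow_natCast,
      ← Real.rpow_add hσ]
    congr 1
    rw [hθ]; ring
  rw [hσt, hfac a, hfac fun _ => σ, ← Finset.prod_mul_distrib, ← Finset.prod_mul_distrib]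
  refine Finset.prod_le_prod (fun i _ => ?_) fun i _ => ?_
  · have := ha i
    have := lt_min hσ this
    split_ifs <;> positivity
  · by_cases h1 : i = m
    · have h2 : ¬ ((i : ℕ) < ⌈t⌉₊ - 1) := by rw [h1]; simp [hmdef]
      rw [if_pos h1, if_pos h1, if_neg h2, if_neg h2, one_mul, one_mul]
      exact rpow_mul_min_le hσ (ha i) hθ0 hθ1
    · rw [if_neg h1, if_neg h1, mul_one, mul_one]
      split_ifs
      · rw [mul_comm]
        exact mul_le_mul_of_nonneg_right (min_le_left _ _) (ha i).le
      · rw [one_mul, one_mul]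
        exact min_le_right _ _

/-- The point with coordinates `u` in the orthonormal frame `v` centred at `c`. -/
def frame (c : Fin d → ℝ) (v : Fin d → Fin d → ℝ) (u : Fin d → ℝ) : Fin d → ℝ :=
  fun l => c l + ∑ m, u m * v m l

variable {c : Fin d → ℝ} {v : Fin d → Fin d → ℝ}

lemma sum_frame_sub_mul (hv : ∀ i j : Fin d, ∑ l, v i l * v j l = if i = j then 1 else 0)
    (u : Fin d → ℝ) (i : Fin d) : ∑ l, (frame c v u l - c l) * v i l = u i := by
  simp only [frame, add_sub_cancel_left, Finset.sum_mul]
  rw [Finset.sum_comm]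
  simp only [mul_assoc, ← Finset.mul_sum, hv]
  simp

lemma frame_sum_sub_mul (hv : ∀ i j : Fin d, ∑ l, v i l * v j l = if i = j then 1 else 0)
    (y : Fin d → ℝ) : frame c v (fun i => ∑ l, (y l - c l) * v i l) = y := by
  have h1 : (Matrix.of v) * (Matrix.of v).transpose = 1 := by
    ext i j
    simp [Matrix.mul_apply, Matrix.one_apply, hv]
  have h2 := mul_eq_one_comm.1 h1
  funext l
  have h3 : ∀ k, ∑ m, v m k * v m l = if k = l then 1 else 0 := by
    intro k
    have := congrFun (congrFun h2 k) l
    simpa [Matrix.mul_apply, Matrix.one_apply] using this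
  simp only [frame, Finset.sum_mul]
  rw [Finset.sum_comm]
  simp only [mul_assoc, ← Finset.mul_sum, h3]
  simp

lemma abs_le_one_of_orthonormal
    (hv : ∀ i j : Fin d, ∑ l, v i l * v j l = if i = j then 1 else 0) (i l : Fin d) :
    |v i l| ≤ 1 := by
  have h := hv i i
  rw [if_pos rfl] at h
  have h1 : v i l * v i l ≤ 1 := h ▸ Finset.single_le_sum
    (f := fun l => v i l * v i l) (fun l _ => mul_self_nonneg _) (Finset.mem_univ l)
  exact abs_le_one_iff_mul_self_le_one.2 h1

/-- The open ellipsoid with centre `c`, axes directed along `v` and semi-axes `a`. -/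
def ellipsoid (c : Fin d → ℝ) (v : Fin d → Fin d → ℝ) (a : Fin d → ℝ) : Set (Fin d → ℝ) :=
  {y | ∑ i, ((∑ l, (y l - c l) * v i l) / a i) ^ 2 < 1}

lemma isBounded_ellipsoid (ha : ∀ i, 0 < a i)
    (hv : ∀ i j : Fin d, ∑ l, v i l * v j l = if i = j then 1 else 0) :
    Bornology.IsBounded (ellipsoid c v a) := by
  refine (isBounded_closedBall (x := c) (r := ∑ i, a i)).subset fun y hy => ?_
  refine (dist_pi_le_iff (Finset.sum_nonneg fun i _ => (ha i).le)).2 fun l => ?_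
  rw [← frame_sum_sub_mul (c := c) hv y, Real.dist_eq, frame, add_sub_cancel_left]
  refine (Finset.abs_sum_le_sum_abs _ _).trans (Finset.sum_le_sum fun i _ => ?_)
  have h1 : ((∑ l, (y l - c l) * v i l) / a i) ^ 2 ≤ 1 :=
    (Finset.single_le_sum (f := fun i => ((∑ l, (y l - c l) * v i l) / a i) ^ 2)
      (fun i _ => sq_nonneg _) (Finset.mem_univ i)).trans hy.le
  rw [sq_le_one_iff_abs_le_one, abs_div, abs_of_pos (ha i), div_le_one (ha i)] at h1
  rw [abs_mul]
  simpa using mul_le_mul h1 (abs_le_one_of_orthonormal hv i l) (abs_nonneg _) (ha i).le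


lemma frame_mem_ellipsoid (hd : 0 < d) (ha : ∀ i, 0 < a i)
    (hv : ∀ i j : Fin d, ∑ l, v i l * v j l = if i = j then 1 else 0)
    {u : Fin d → ℝ} (hu : ∀ i, |u i| < a i / d) : frame c v u ∈ ellipsoid c v a := by
  have hd' : (1 : ℝ) ≤ d := by exact_mod_cast hd
  have : Nonempty (Fin d) := ⟨⟨0, hd⟩⟩
  show ∑ i, ((∑ l, (frame c v u l - c l) * v i l) / a i) ^ 2 < 1
  simp only [sum_frame_sub_mul hv]
  calc ∑ i, (u i / a i) ^ 2 < ∑ _i : Fin d, (1 / d : ℝ) := by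
        refine Finset.sum_lt_sum_of_nonempty Finset.univ_nonempty fun i _ => ?_
        have h1 : |u i / a i| < 1 / d := by
          rw [abs_div, abs_of_pos (ha i), div_lt_iff₀ (ha i)]
          calc |u i| < a i / d := hu i
            _ = 1 / d * a i := by ring
        have h2 : (1 / d : ℝ) ≤ 1 := by
          rw [div_le_one (by linarith)]; exact hd'
        rw [← sq_abs]
        nlinarith [abs_nonneg (u i / a i)]
    _ = 1 := by
        rw [Finset.sum_const, Finset.card_univ, Fintype.card_fin, nsmul_eq_mul,
          mul_one_div_cancel (by linarith)]

/-- Coordinates in the central part of an ellipsoid of diameter `< 1` are controlled by the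
distance in the torus. -/
lemma abs_sub_le_of_dist_torusProj_le (hd : 0 < d) (ha : ∀ i, 0 < a i)
    (hv : ∀ i j : Fin d, ∑ l, v i l * v j l = if i = j then 1 else 0)
    (hdiam : diam (ellipsoid c v a) < 1) {u u' : Fin d → ℝ} (hu : ∀ i, |u i| < a i / (2 * d))
    (hu' : ∀ i, |u' i| < a i / (2 * d)) {ρ : ℝ}
    (h : dist (torusProj (frame c v u)) (torusProj (frame c v u')) ≤ ρ) (i : Fin d) :
    |u i - u' i| ≤ d * ρ := by
  have hdpos : (0 : ℝ) < d := by exact_mod_cast hd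
  have hdouble : ∀ w : Fin d → ℝ, (∀ i, |w i| < a i / (2 * d)) →
      frame c v (fun i => 2 * w i) ∈ ellipsoid c v a := by
    intro w hw
    refine frame_mem_ellipsoid hd ha hv fun i => ?_
    rw [abs_mul, abs_two]
    calc 2 * |w i| < 2 * (a i / (2 * d)) := by linarith [hw i]
      _ = a i / d := by field_simp
  have hlt : dist (frame c v fun i => 2 * u i) (frame c v fun i => 2 * u' i) < 1 :=
    (dist_le_diam_of_mem (isBounded_ellipsoid ha hv) (hdouble u hu) (hdouble u' hu')).trans_lt
      hdiam
  have hcoord : ∀ l, |frame c v u l - frame c v u' l| ≤ ρ := by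
    intro l
    have h1 : |2 * (frame c v u l - frame c v u' l)| < 1 := by
      have h2 := (dist_le_pi_dist (frame c v fun i => 2 * u i) (frame c v fun i => 2 * u' i)
        l).trans_lt hlt
      have e : ∀ w : Fin d → ℝ, frame c v (fun i => 2 * w i) l = 2 * frame c v w l - c l := by
        intro w
        simp only [frame, mul_assoc, ← Finset.mul_sum]
        ring
      rwa [Real.dist_eq, e, e, sub_sub_sub_cancel_right, ← mul_sub] at h2
    rw [abs_mul, abs_two] at h1
    have h3 := (dist_le_pi_dist _ _ l).trans h
    rwa [dist_eq_norm, torusProj, torusProj, ← AddCircle.coe_sub,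
      (AddCircle.norm_coe_eq_abs_iff 1 one_ne_zero).2 (by rw [abs_one]; linarith)] at h3
  rw [← sum_frame_sub_mul (c := c) hv u i, ← sum_frame_sub_mul (c := c) hv u' i,
    ← Finset.sum_sub_distrib]
  calc _ ≤ ∑ l, |(frame c v u l - c l) * v i l - (frame c v u' l - c l) * v i l| :=
        Finset.abs_sum_le_sum_abs _ _
    _ ≤ ∑ _l : Fin d, ρ := by
        refine Finset.sum_le_sum fun l _ => ?_
        rw [← sub_mul, sub_sub_sub_cancel_right, abs_mul]
        have := mul_le_mul (hcoord l) (abs_le_one_of_orthonormal hv i l) (abs_nonneg _)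
          ((abs_nonneg _).trans (hcoord l))
        linarith
    _ = d * ρ := by simp

lemma pow_mul_prod (κ : ℝ) (b : Fin d → ℝ) : κ ^ d * ∏ i, b i = ∏ i, κ * b i := by
  simp [Finset.prod_mul_distrib]

/-- The Hausdorff content of an ellipsoid is bounded below by its singular value function. -/
theorem singularValueFunction_le_tsum (hd : 0 < d) {U : Set (Torus d)}
    (hU : IsEllipsoidWithSemiaxes U a) (ht0 : 0 < t) (htd : t ≤ d) {ι : Type*} [Countable ι]
    {A : ι → Set (Torus d)} (hcov : U ⊆ ⋃ k, A k) {ρ : ι → ℝ} (hρ : ∀ k, 0 < ρ k)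
    (hA : ∀ k, ∀ x ∈ A k, ∀ y ∈ A k, dist x y ≤ ρ k) :
    ENNReal.ofReal (singularValueFunction a t) ≤
      ENNReal.ofReal ((d : ℝ) ^ 2) ^ t * ∑' k, ENNReal.ofReal (ρ k) ^ t := by
  obtain ⟨ha, -, c, v, hv, hdiam, rfl⟩ := hU
  have hdpos : (0 : ℝ) < d := by exact_mod_cast hd
  set P : Set (Fin d → ℝ) := Set.univ.pi fun i => Set.Ioo (-(a i / (2 * d))) (a i / (2 * d))
  have hP : ∀ u ∈ P, ∀ i, |u i| < a i / (2 * d) := fun u hu i => abs_lt.2 (hu i (mem_univ i))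
  have hPvol : volume P = ENNReal.ofReal ((1 / d) ^ d * ∏ i, a i) := by
    rw [Real.volume_pi_Ioo, ← ENNReal.ofReal_prod_of_nonneg]
    · rw [pow_mul_prod]
      congr 1
      refine Finset.prod_congr rfl fun i _ => ?_
      field_simp
      ring
    · intro i _
      have := ha i
      have : 0 < a i / (2 * d) := by positivity
      linarith
  set B : ι → Set (Fin d → ℝ) := fun k => P ∩ {u | torusProj (frame c v u) ∈ A k}
  have hcovP : P ⊆ ⋃ k, B k := by
    intro u hu
    have hmem : torusProj (frame c v u) ∈ ⋃ k, A k := by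
      refine hcov ⟨_, frame_mem_ellipsoid hd ha hv fun i => (hP u hu i).trans_le ?_, rfl⟩
      exact div_le_div_of_nonneg_left (ha i).le hdpos (by linarith)
    obtain ⟨k, hk⟩ := mem_iUnion.1 hmem
    exact mem_iUnion.2 ⟨k, hu, hk⟩
  have hBvol : ∀ k, volume (B k) ≤
      ENNReal.ofReal ((1 / d) ^ d * ∏ i, min ((d : ℝ) ^ 2 * ρ k) (a i)) := by
    intro k
    refine (Real.volume_pi_le_prod_diam _).trans ?_
    rw [pow_mul_prod, ENNReal.ofReal_prod_of_nonneg]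
    · refine Finset.prod_le_prod' fun i _ => ediam_le ?_
      rintro _ ⟨u, hu, rfl⟩ _ ⟨u', hu', rfl⟩
      rw [edist_dist, Real.dist_eq]
      refine ENNReal.ofReal_le_ofReal ?_
      have h1 := abs_sub_le_of_dist_torusProj_le hd ha hv hdiam (hP u hu.1) (hP u' hu'.1)
        (hA k _ hu.2 _ hu'.2) i
      have h2 : |u i - u' i| ≤ a i / d := by
        have e : a i / d = a i / (2 * d) + a i / (2 * d) := by field_simp; ring
        rw [e]
        exact (abs_sub _ _).trans (add_le_add (hP u hu.1 i).le (hP u' hu'.1 i).le)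
      simp only [Function.eval]
      rw [one_div, inv_mul_eq_div, le_div_iff₀ hdpos, le_min_iff]
      rw [le_div_iff₀ hdpos] at h2
      exact ⟨by nlinarith, h2⟩
    · intro i _
      have := ha i
      have := hρ k
      have : 0 < min ((d : ℝ) ^ 2 * ρ k) (a i) := lt_min (by positivity) (ha i)
      positivity
  set Q : ℝ := (1 / d) ^ d * ∏ i, a i with hQ
  have hQpos : 0 < Q := mul_pos (by positivity) (Finset.prod_pos fun i _ => ha i)
  have hφ := (singularValueFunction_pos (t := t) ha).le
  have key : ENNReal.ofReal (singularValueFunction a t) * ENNReal.ofReal Q ≤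
      (ENNReal.ofReal ((d : ℝ) ^ 2) ^ t * ∑' k, ENNReal.ofReal (ρ k) ^ t) * ENNReal.ofReal Q := by
    calc ENNReal.ofReal (singularValueFunction a t) * ENNReal.ofReal Q
        ≤ ENNReal.ofReal (singularValueFunction a t) *
          ∑' k, ENNReal.ofReal ((1 / d) ^ d * ∏ i, min ((d : ℝ) ^ 2 * ρ k) (a i)) := by
          gcongr
          rw [← hPvol]
          exact (measure_mono hcovP).trans ((measure_iUnion_le _).trans
            (ENNReal.tsum_le_tsum hBvol))
      _ ≤ ∑' k, ENNReal.ofReal ((d : ℝ) ^ 2) ^ t * ENNReal.ofReal (ρ k) ^ t *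
          ENNReal.ofReal Q := by
          rw [← ENNReal.tsum_mul_left]
          refine ENNReal.tsum_le_tsum fun k => ?_
          have hσ : 0 < (d : ℝ) ^ 2 * ρ k := mul_pos (by positivity) (hρ k)
          rw [← ENNReal.mul_rpow_of_nonneg _ _ ht0.le, ← ENNReal.ofReal_mul (p := (d : ℝ) ^ 2) (by positivity),
            ENNReal.ofReal_rpow_of_pos hσ, ← ENNReal.ofReal_mul hφ,
            ← ENNReal.ofReal_mul (by positivity)]
          refine ENNReal.ofReal_le_ofReal ?_
          have := singularValueFunction_mul_prod_min_le ha ht0 htd hσ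
          have h1 : (0 : ℝ) ≤ (1 / d) ^ d := by positivity
          rw [hQ]
          nlinarith
      _ = _ := by
          rw [ENNReal.tsum_mul_right, ENNReal.tsum_mul_left]
  rwa [ENNReal.mul_le_mul_iff_left (by simpa using hQpos) ENNReal.ofReal_ne_top] at key

lemma IsEllipsoidWithSemiaxes.isOpen {U : Set (Torus d)} (hU : IsEllipsoidWithSemiaxes U a) :
    IsOpen U := by
  obtain ⟨-, -, c, v, -, -, rfl⟩ := hU
  have hopen : IsOpenMap (torusProj (d := d)) :=
    IsOpenMap.piMap (fun _ => QuotientAddGroup.isOpenMap_coe)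
      (Filter.Eventually.of_forall fun _ => QuotientAddGroup.mk_surjective)
  refine hopen _ (isOpen_lt ?_ continuous_const)
  fun_prop

end Ellipsoid

section Covering

variable {d : ℕ}

lemma volume_closedBall_le (x : Torus d) {R : ℝ} (hR : 0 ≤ R) :
    volume (closedBall x R) ≤ ENNReal.ofReal (2 * R) ^ d := by
  rw [volume_pi_closedBall x hR]
  calc _ ≤ ∏ _i : Fin d, ENNReal.ofReal (2 * R) := by
        refine Finset.prod_le_prod' fun i _ => ?_
        rw [AddCircle.volume_closedBall]
        exact ENNReal.ofReal_le_ofReal (min_le_right _ _)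
    _ = _ := by simp

lemma le_volume_ball (x : Torus d) {R : ℝ} (hR : 0 < R) (hR1 : R ≤ 1) :
    ENNReal.ofReal R ^ d ≤ volume (ball x R) := by
  refine le_trans ?_ (measure_mono (closedBall_subset_ball (half_lt_self hR)))
  rw [volume_pi_closedBall x (by linarith)]
  simp only [AddCircle.volume_closedBall, mul_div_cancel₀ R two_ne_zero, min_eq_right hR1]
  simp

/-- A disjoint family of small balls from a limsup set of full measure fills a fixed
proportion of any ball. -/
lemma exists_disjoint_balls {x : ℕ → Torus d} {r : ℕ → ℝ} (hr : ∀ j, 0 < r j)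
    (hrlim : Tendsto r atTop (𝓝 0))
    (hfull : volume ((⋂ k, ⋃ j, ⋃ (_ : k ≤ j), ball (x j) (r j))ᶜ) = 0) (N : ℕ) (z : Torus d)
    {R δ : ℝ} (hR1 : R ≤ 1) (hδ : 0 < δ) (hδR : δ ≤ R / 8) :
    ∃ u : Set ℕ, (∀ j ∈ u, N ≤ j ∧ r j ≤ δ ∧ ball (x j) (r j) ⊆ ball z R) ∧
      (u.PairwiseDisjoint fun j => closedBall (x j) (3 * r j)) ∧
      ENNReal.ofReal (R / 60) ^ d ≤ ∑' j : u, volume (ball (x j) (r j)) := by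
  set J : Set ℕ := {j | N ≤ j ∧ r j ≤ δ ∧ (ball (x j) (r j) ∩ ball z (R / 2)).Nonempty} with hJ
  obtain ⟨u, huJ, hdisj, hcov⟩ := Vitali.exists_disjoint_subfamily_covering_enlargement_closedBall
    J x (fun j => 3 * r j) (3 * δ) (fun j hj => by linarith [hj.2.1]) 5 (by norm_num)
  refine ⟨u, fun j hj => ⟨(huJ hj).1, (huJ hj).2.1, fun y hy => ?_⟩, hdisj, ?_⟩
  · obtain ⟨-, h1, w, hw, hw'⟩ := huJ hj
    rw [mem_ball] at hy hw hw' ⊢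
    linarith [dist_triangle y (x j) z, dist_triangle (x j) w z, dist_comm w (x j)]
  · have hmeas : volume (ball z (R / 2)) ≤ ∑' j : u, ENNReal.ofReal (30 * r j) ^ d := by
      calc volume (ball z (R / 2)) ≤ volume ((⋂ k, ⋃ j, ⋃ (_ : k ≤ j), ball (x j) (r j))ᶜ ∪
            ⋃ j ∈ u, closedBall (x j) (5 * (3 * r j))) := by
            refine measure_mono fun y hy => ?_
            by_cases hyE : y ∈ ⋂ k, ⋃ j, ⋃ (_ : k ≤ j), ball (x j) (r j)
            · right
              obtain ⟨N', hN'⟩ := eventually_atTop.1 (hrlim.eventually_le_const hδ)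
              obtain ⟨j, hj, hyj⟩ := mem_iUnion₂.1 (mem_iInter.1 hyE (max N N'))
              obtain ⟨b, hb, hsub⟩ := hcov j ⟨(le_max_left _ _).trans hj,
                hN' j ((le_max_right _ _).trans hj), y, hyj, hy⟩
              exact mem_iUnion₂.2 ⟨b, hb, hsub (closedBall_subset_closedBall
                (by linarith [hr j]) (ball_subset_closedBall hyj))⟩
            · exact Or.inl hyE
        _ ≤ 0 + ∑' j : u, volume (closedBall (x j) (5 * (3 * r j))) := by
            refine (measure_union_le _ _).trans ?_
            rw [hfull]
            gcongr
            exact measure_biUnion_le _ u.to_countable _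
        _ ≤ _ := by
            rw [zero_add]
            refine ENNReal.tsum_le_tsum fun j => ?_
            refine (volume_closedBall_le _ (by linarith [hr j])).trans_eq ?_
            congr 2
            ring
    have h30 : ENNReal.ofReal 30 ^ d ≠ 0 := by simp
    rw [← ENNReal.mul_le_mul_iff_right h30 (by finiteness), ← ENNReal.tsum_mul_left, ← mul_pow,
      ← ENNReal.ofReal_mul (by norm_num)]
    calc _ = ENNReal.ofReal (R / 2) ^ d := by congr 2; ring
      _ ≤ volume (ball z (R / 2)) := le_volume_ball _ (by linarith) (by linarith)
      _ ≤ ∑' j : u, ENNReal.ofReal (30 * r j) ^ d := hmeas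
      _ ≤ _ := by
          refine ENNReal.tsum_le_tsum fun j => ?_
          rw [ENNReal.ofReal_mul (by norm_num), mul_pow]
          gcongr
          refine le_volume_ball _ (hr j) ?_
          linarith [(huJ j.2).2.1]

/-- The gauge `n ↦ (2^{-n})^t` of the dyadic grid. -/
def gauge (t : ℝ) (n : ℕ) : ℝ≥0∞ := ENNReal.ofReal ((1 / 2) ^ n) ^ t

variable {t : ℝ}

lemma gauge_ne_zero (n : ℕ) : gauge t n ≠ 0 := by
  exact (ENNReal.rpow_pos (by simp) ENNReal.ofReal_ne_top).ne'

lemma gauge_ne_top (ht : 0 ≤ t) (n : ℕ) : gauge t n ≠ ⊤ :=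
  ENNReal.rpow_ne_top_of_nonneg ht ENNReal.ofReal_ne_top

lemma gauge_antitone (ht : 0 ≤ t) : Antitone (gauge t) := fun m n h =>
  ENNReal.rpow_le_rpow (ENNReal.ofReal_le_ofReal
    (pow_le_pow_of_le_one (by norm_num) (by norm_num) h)) ht

lemma gauge_eq_mul_succ (ht : 0 ≤ t) (n : ℕ) : gauge t n = 2 ^ t * gauge t (n + 1) := by
  rw [gauge, gauge, ← ENNReal.mul_rpow_of_nonneg _ _ ht, ← ENNReal.ofReal_ofNat,
    ← ENNReal.ofReal_mul (by norm_num)]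
  congr 2
  rw [pow_succ]; ring

lemma gauge_add_sub_le {t' : ℝ} (ht : t ≤ t') {n : ℕ} {δ : ℝ} (hδ : (1 / 2) ^ n ≤ δ) :
    gauge t' n ≤ ENNReal.ofReal δ ^ (t' - t) * gauge t n := by
  have e : t' = (t' - t) + t := by ring
  conv_lhs => rw [e, gauge, ENNReal.rpow_add _ _ (by simp) ENNReal.ofReal_ne_top]
  rw [gauge]
  gcongr

lemma gauge_natCast (n : ℕ) : gauge d n = ENNReal.ofReal ((1 / 2) ^ n) ^ d := by
  rw [gauge, ENNReal.rpow_natCast]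

end Covering

section Escape

variable {d : ℕ}

lemma tsum_tsum_le_of_pairwiseDisjoint {ι α : Type*} {u : Set ι} {S : ι → Set α} {T : Set α}
    (hS : u.PairwiseDisjoint S) (hST : ∀ j ∈ u, S j ⊆ T) (f : α → ℝ≥0∞) :
    ∑' j : u, ∑' m : S j, f m ≤ ∑' m : T, f m := by
  rw [← ENNReal.tsum_biUnion' hS]
  exact ENNReal.tsum_mono_subtype f (iUnion₂_subset hST)

/-- A family of cells of small total gauge cannot cover the part of a cell that lies in a
tail union of the ellipsoids. -/
theorem exists_mem_interior_cell_notMem (hd : 0 < d) {x : ℕ → Torus d} {r : ℕ → ℝ}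
    (hr : ∀ j, 0 < r j) (hrlim : Tendsto r atTop (𝓝 0))
    (hfull : volume ((⋂ k, ⋃ j, ⋃ (_ : k ≤ j), ball (x j) (r j))ᶜ) = 0)
    {U : ℕ → Set (Torus d)} {a : ℕ → Fin d → ℝ}
    (hell : ∀ j, IsEllipsoidWithSemiaxes (U j) (a j))
    (hUB : ∀ j, U j ⊆ ball (x j) (r j)) {t t' : ℝ} (ht : 0 < t) (htt' : t < t') (ht' : t' ≤ d)
    {C : ℝ≥0∞} (hC : C ≠ ⊤)
    (hφ : ∀ j, volume (ball (x j) (r j)) ≤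
      C * ENNReal.ofReal (singularValueFunction (a j) t'))
    (N : ℕ) (p : ℕ × (Fin d → ℤ)) (M : Set (ℕ × (Fin d → ℤ)))
    (hp : (cell gridLabel p).Nonempty)
    (hM : cellMass gridLabel (gauge t) M p ≤ (2 * 720 ^ d)⁻¹ * gauge t p.1) :
    ∃ y ∈ (⋃ j, ⋃ (_ : N ≤ j), U j) ∩ interior (cell gridLabel p),
      ∀ m ∈ M, y ∉ cell gridLabel m := by
  by_contra! hcon
  obtain ⟨z, hz⟩ := exists_ball_subset_cell hp
  set ε : ℝ≥0∞ := (2 * 720 ^ d)⁻¹ with hε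
  have hε1 : ε ≤ 1 := by
    rw [hε, ENNReal.inv_le_one]
    exact one_le_mul (by norm_num) (one_le_pow₀ (by norm_num))
  set R : ℝ := (1 / 2) ^ p.1 / 2 with hRdef
  have hR : 0 < R := by positivity
  have hR1 : R ≤ 1 := by
    have : ((1 : ℝ) / 2) ^ p.1 ≤ 1 := pow_le_one₀ (by norm_num) (by norm_num)
    rw [hRdef]; linarith
  set X : ℝ≥0∞ := ENNReal.ofReal (R / 60) ^ d with hX
  have hX0 : X ≠ 0 := pow_ne_zero _ (by simpa using hR)
  have hXtop : X ≠ ⊤ := by finiteness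
  set Mp : Set (ℕ × (Fin d → ℤ)) :=
    {m | m ∈ M ∧ (cell gridLabel m ∩ cell gridLabel p).Nonempty} with hMp
  have hmass : ∑' m : Mp, gauge t m.1.1 ≤ ε * gauge t p.1 := by
    rw [tsum_subtype Mp fun m => gauge t m.1]
    exact hM
  have hMple : ∀ m ∈ Mp, gauge t m.1 ≤ gauge t p.1 := fun m hm =>
    (ENNReal.le_tsum (f := fun m : Mp => gauge t m.1.1) ⟨m, hm⟩).trans
      (hmass.trans (mul_le_of_le_one_left' hε1))
  have hmp : ∀ m ∈ Mp, ((1 : ℝ) / 2) ^ m.1 ≤ (1 / 2) ^ p.1 := by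
    intro m hm
    have := (ENNReal.rpow_le_rpow_iff ht).1 (hMple m hm)
    rwa [ENNReal.ofReal_le_ofReal_iff (by positivity)] at this
  set K : ℝ≥0∞ := C * ENNReal.ofReal ((d : ℝ) ^ 2) ^ t' with hK
  have ht'0 : 0 < t' := ht.trans htt'
  have hKtop : K ≠ ⊤ :=
    ENNReal.mul_ne_top hC (ENNReal.rpow_ne_top_of_nonneg ht'0.le ENNReal.ofReal_ne_top)
  have hLtop : K * (ε * gauge t p.1) ≠ ⊤ :=
    ENNReal.mul_ne_top hKtop (ENNReal.mul_ne_top (hε1.trans_lt ENNReal.one_lt_top).ne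
      (gauge_ne_top ht.le _))
  obtain ⟨η, hη0, hη⟩ := ENNReal.exists_nnreal_pos_mul_lt hLtop (ENNReal.half_pos hX0).ne'
  have hθ : 0 < t' - t := sub_pos.2 htt'
  set δ : ℝ := min (R / 8) ((η : ℝ) ^ (t' - t)⁻¹) with hδdef
  have hδ : 0 < δ := lt_min (by linarith) (Real.rpow_pos_of_pos (by exact_mod_cast hη0) _)
  have hδη : ENNReal.ofReal δ ^ (t' - t) ≤ η := by
    calc ENNReal.ofReal δ ^ (t' - t) ≤ ENNReal.ofReal ((η : ℝ) ^ (t' - t)⁻¹) ^ (t' - t) := by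
          gcongr; exact min_le_right _ _
      _ = η := by
          rw [← ENNReal.ofReal_rpow_of_pos (by exact_mod_cast hη0), ← ENNReal.rpow_mul,
            inv_mul_cancel₀ hθ.ne', ENNReal.rpow_one, ENNReal.ofReal_coe_nnreal]
  obtain ⟨u, hu, hdisj, hXu⟩ :=
    exists_disjoint_balls hr hrlim hfull N z hR1 hδ (min_le_left _ _)
  have hBdisj : u.PairwiseDisjoint fun j => ball (x j) (r j) := fun i hi j hj hij =>
    (hdisj hi hj hij).mono
      (ball_subset_closedBall.trans (closedBall_subset_closedBall (by linarith [hr i])))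
      (ball_subset_closedBall.trans (closedBall_subset_closedBall (by linarith [hr j])))
  set u₁ : Set ℕ := {j | j ∈ u ∧ ∃ m ∈ Mp, (ball (x j) (r j) ∩ cell gridLabel m).Nonempty ∧
    r j ≤ (1 / 2) ^ m.1} with hu₁
  set u₂ : Set ℕ := {j | j ∈ u ∧ ∀ m ∈ Mp, (ball (x j) (r j) ∩ cell gridLabel m).Nonempty →
    (1 / 2) ^ m.1 < r j} with hu₂
  have huu : u ⊆ u₁ ∪ u₂ := by
    intro j hj
    by_cases h : j ∈ u₂
    · exact Or.inr h
    · left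
      refine ⟨hj, ?_⟩
      by_contra! h'
      exact h ⟨hj, h'⟩
  have hsum₁ : ∑' j : u₁, volume (ball (x j) (r j)) ≤ X / 2 := by
    have hex : ∀ m : Mp, ∃ y, y ∈ cell gridLabel m.1 := fun m => ⟨_, m.2.2.choose_spec.1⟩
    choose y hy using hex
    rw [← measure_biUnion u₁.to_countable (hBdisj.subset fun j hj => hj.1)
      fun j _ => measurableSet_ball]
    calc volume (⋃ j ∈ u₁, ball (x j) (r j))
        ≤ volume (⋃ m : Mp, closedBall (y m) (3 * (1 / 2) ^ m.1.1)) := by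
          refine measure_mono (iUnion₂_subset fun j hj w hw => ?_)
          obtain ⟨-, m, hm, ⟨v, hv, hvm⟩, hrm⟩ := hj
          refine mem_iUnion.2 ⟨⟨m, hm⟩, ?_⟩
          have h1 := dist_le_of_gridLabel_eq m.1 v (y ⟨m, hm⟩) (hvm.trans (hy ⟨m, hm⟩).symm)
          rw [mem_ball] at hw hv
          rw [mem_closedBall]
          linarith [dist_triangle w (x j) (y ⟨m, hm⟩), dist_triangle (x j) v (y ⟨m, hm⟩),
            dist_comm v (x j)]
      _ ≤ ∑' m : Mp, 6 ^ d * ENNReal.ofReal ((1 / 2) ^ p.1) ^ ((d : ℝ) - t) * gauge t m.1.1 := by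
          refine (measure_iUnion_le _).trans (ENNReal.tsum_le_tsum fun m => ?_)
          refine (volume_closedBall_le _ (by positivity)).trans ?_
          have e : (2 : ℝ) * (3 * (1 / 2) ^ m.1.1) = 6 * (1 / 2) ^ m.1.1 := by ring
          rw [e, ENNReal.ofReal_mul (by norm_num), mul_pow, ← gauge_natCast, mul_assoc,
            ENNReal.ofReal_ofNat]
          gcongr
          exact gauge_add_sub_le (by linarith) (hmp m m.2)
      _ ≤ 6 ^ d * ENNReal.ofReal ((1 / 2) ^ p.1) ^ ((d : ℝ) - t) * (ε * gauge t p.1) := by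
          rw [ENNReal.tsum_mul_left]
          gcongr
      _ = ε * (6 * ENNReal.ofReal ((1 / 2) ^ p.1)) ^ d := by
          have h0 : ENNReal.ofReal ((1 / 2) ^ p.1) ≠ 0 := by simp
          have h1 : ENNReal.ofReal ((1 / 2) ^ p.1) ^ d =
              ENNReal.ofReal ((1 / 2) ^ p.1) ^ ((d : ℝ) - t) * gauge t p.1 := by
            rw [gauge, ← ENNReal.rpow_add _ _ h0 ENNReal.ofReal_ne_top, sub_add_cancel,
              ENNReal.rpow_natCast]
          rw [mul_pow, h1]
          ring
      _ = X / 2 := by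
          have e : ((1 : ℝ) / 2) ^ p.1 = 120 * (R / 60) := by rw [hRdef]; ring
          rw [e, ENNReal.ofReal_mul (by norm_num), ← mul_assoc, mul_pow, ← hX,
            ENNReal.ofReal_ofNat, hε, ENNReal.mul_inv (by simp) (by simp)]
          have e6 : (6 * 120 : ℝ≥0∞) = 720 := by norm_num
          rw [e6, mul_assoc, ← mul_assoc ((720 : ℝ≥0∞) ^ d)⁻¹,
            ENNReal.inv_mul_cancel (by simp) (by finiteness), one_mul, mul_comm, div_eq_mul_inv]
  have hsum₂ : ∑' j : u₂, volume (ball (x j) (r j)) < X / 2 := by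
    set S : ℕ → Set (ℕ × (Fin d → ℤ)) :=
      fun j => {m | m ∈ Mp ∧ (U j ∩ cell gridLabel m).Nonempty} with hS
    have hSmeet : ∀ j, ∀ m ∈ S j, (ball (x j) (r j) ∩ cell gridLabel m).Nonempty := fun j m hm =>
      hm.2.mono (inter_subset_inter_left _ (hUB j))
    have hSdisj : u₂.PairwiseDisjoint S := by
      intro i hi j hj hij
      refine Set.disjoint_left.2 fun m hmi hmj => ?_
      obtain ⟨v, hv, hvm⟩ := hSmeet i m hmi
      obtain ⟨w, hw, hwm⟩ := hSmeet j m hmj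
      have h1 := dist_le_of_gridLabel_eq m.1 w v (hwm.trans hvm.symm)
      have h2 := hi.2 m hmi.1 (hSmeet i m hmi)
      rw [mem_ball] at hv hw
      have hwi : w ∈ closedBall (x i) (3 * r i) := by
        rw [mem_closedBall]
        linarith [dist_triangle w v (x i), hr i]
      have hwj : w ∈ closedBall (x j) (3 * r j) := by
        rw [mem_closedBall]
        linarith [hr j]
      exact Set.disjoint_left.1 (hdisj hi.1 hj.1 hij) hwi hwj
    calc ∑' j : u₂, volume (ball (x j) (r j))
        ≤ ∑' j : u₂, ∑' m : S j, K * η * gauge t m.1.1 := by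
          refine ENNReal.tsum_le_tsum fun j => (hφ j).trans ?_
          have hcov : U j ⊆ ⋃ m : S j, cell gridLabel m.1 := by
            intro y hy
            have hyp := (hu j j.2.1).2.2 (hUB j hy)
            obtain ⟨m, hm, hym⟩ := hcon y ⟨mem_iUnion₂.2 ⟨j, (hu j j.2.1).1, hy⟩,
              interior_maximal hz isOpen_ball hyp⟩
            exact mem_iUnion.2 ⟨⟨m, ⟨hm, y, hym, hz hyp⟩, y, hy, hym⟩, hym⟩
          have hcontent := singularValueFunction_le_tsum hd (hell j) ht'0 ht' hcov
            (ρ := fun m => (1 / 2) ^ m.1.1) (fun m => by positivity)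
            fun m v hv w hw => dist_le_of_gridLabel_eq _ _ _ (hv.trans hw.symm)
          refine (mul_le_mul_right hcontent C).trans ?_
          rw [← mul_assoc, ← hK]
          calc _ ≤ K * ∑' m : S j, η * gauge t m.1.1 := by
                refine mul_le_mul_right (ENNReal.tsum_le_tsum fun m => ?_) K
                refine (gauge_add_sub_le htt'.le (δ := δ) ?_).trans (mul_le_mul_left hδη _)
                exact (j.2.2 m m.2.1 (hSmeet j m m.2)).le.trans (hu j j.2.1).2.1
            _ = _ := by
                rw [← ENNReal.tsum_mul_left]
                simp only [mul_assoc]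
      _ ≤ ∑' m : Mp, K * η * gauge t m.1.1 :=
          tsum_tsum_le_of_pairwiseDisjoint hSdisj (fun j _ m hm => hm.1)
            fun m => K * η * gauge t m.1
      _ ≤ K * η * (ε * gauge t p.1) := by
          rw [ENNReal.tsum_mul_left]
          gcongr
      _ = η * (K * (ε * gauge t p.1)) := by ring
      _ < X / 2 := hη
  have : X < X := by
    calc X ≤ ∑' j : u, volume (ball (x j) (r j)) := hXu
      _ ≤ ∑' j : ↑(u₁ ∪ u₂), volume (ball (x j) (r j)) :=
          ENNReal.tsum_mono_subtype (fun j => volume (ball (x j) (r j))) huu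
      _ ≤ ∑' j : u₁, volume (ball (x j) (r j)) + ∑' j : u₂, volume (ball (x j) (r j)) :=
          ENNReal.tsum_union_le (fun j => volume (ball (x j) (r j))) u₁ u₂
      _ < X / 2 + X / 2 := ENNReal.add_lt_add_of_le_of_lt
          (ne_top_of_le_ne_top (ENNReal.div_ne_top hXtop two_ne_zero) hsum₁) hsum₁ hsum₂
      _ = X := ENNReal.add_halves X
  exact this.false

end Escape

section Conclusion

variable {d : ℕ} {E : Set (Torus d)} {t : ℝ}

/-- The `t`-dimensional dyadic content of `E` is full in every cell of the dyadic grid. -/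
def HasFullContent (E : Set (Torus d)) (t : ℝ) : Prop :=
  ∀ (p : ℕ × (Fin d → ℤ)) (F : Set (ℕ × (Fin d → ℤ))), (cell gridLabel p).Nonempty →
    E ∩ cell gridLabel p ⊆ ⋃ c ∈ F, cell gridLabel c → gauge t p.1 ≤ ∑' c : F, gauge t c.1.1

theorem hasFullContent_limsup (hd : 0 < d) {x : ℕ → Torus d} {r : ℕ → ℝ}
    (hr : ∀ j, 0 < r j) (hrlim : Tendsto r atTop (𝓝 0))
    (hfull : volume ((⋂ k, ⋃ j, ⋃ (_ : k ≤ j), ball (x j) (r j))ᶜ) = 0)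
    {U : ℕ → Set (Torus d)} {a : ℕ → Fin d → ℝ}
    (hell : ∀ j, IsEllipsoidWithSemiaxes (U j) (a j))
    (hUB : ∀ j, U j ⊆ ball (x j) (r j)) {t' : ℝ} (ht : 0 < t) (htt' : t < t') (ht' : t' ≤ d)
    {C : ℝ≥0∞} (hC : C ≠ ⊤)
    (hφ : ∀ j, volume (ball (x j) (r j)) ≤
      C * ENNReal.ofReal (singularValueFunction (a j) t')) :
    HasFullContent (⋂ k, ⋃ j, ⋃ (_ : k ≤ j), U j) t := by
  intro p F hp hF
  rw [tsum_subtype F fun c => gauge t c.1]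
  have h2 : (2 : ℝ≥0∞) ^ t < ((2 ^ d : ℕ) : ℝ≥0∞) := by
    rw [Nat.cast_pow, Nat.cast_ofNat, ← ENNReal.rpow_natCast]
    exact ENNReal.rpow_lt_rpow_of_exponent_lt (by norm_num) (by simp) (by linarith)
  exact Refining.le_tsum_of_iInter_subset refining_gridLabel dist_le_of_gridLabel_eq
    branching_gridLabel h2 (gauge_antitone ht.le) (fun n => (gauge_eq_mul_succ ht.le n).le)
    gauge_ne_zero (gauge_ne_top ht.le)
    (fun k => isOpen_iUnion fun j => isOpen_iUnion fun _ =>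
      IsEllipsoidWithSemiaxes.isOpen (hell j))
    (ENNReal.inv_pos.2 (by finiteness))
    (exists_mem_interior_cell_notMem hd hr hrlim hfull hell hUB ht htt' ht' hC hφ) hp hF

lemma ediam_le_one_of_isDyadicCube {D : Set (Torus d)} (hD : IsDyadicCube D) :
    ediam D ≤ 1 := by
  obtain ⟨p, rfl, -⟩ := IsDyadicCube.exists_cell hD
  refine (ediam_cell_le p).trans ?_
  rw [← ENNReal.ofReal_one]
  exact ENNReal.ofReal_le_ofReal (pow_le_one₀ (by norm_num) (by norm_num))

lemma dyadicContent_eq_top_of_nonpos (ht : t ≤ 0) : dyadicContent t E = ⊤ := by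
  refine iInf_eq_top.2 fun f => iInf_eq_top.2 fun hf => iInf_eq_top.2 fun _ => ?_
  refine top_unique ?_
  rw [← ENNReal.tsum_const_eq_top_of_ne_zero (α := ℕ) one_ne_zero]
  refine ENNReal.tsum_le_tsum fun n => ?_
  have h1 : ediam (f n) ^ (-t) ≤ 1 :=
    ENNReal.rpow_le_one (ediam_le_one_of_isDyadicCube (hf n)) (by linarith)
  rw [ENNReal.rpow_neg, ENNReal.inv_le_one] at h1
  exact h1

lemma HasFullContent.ediam_rpow_le_dyadicContent (hd : 0 < d) (hE : HasFullContent E t)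
    (ht : 0 < t) {D : Set (Torus d)} (hD : IsDyadicCube D) :
    ediam D ^ t ≤ dyadicContent t (E ∩ D) := by
  obtain ⟨p, rfl, z, hz⟩ := IsDyadicCube.exists_cell hD
  set q : ℕ × (Fin d → ℤ) := (max p.1 1, gridLabel (max p.1 1) z) with hq
  have hzq : z ∈ cell gridLabel q := rfl
  have hqp : cell gridLabel q ⊆ cell gridLabel p :=
    refining_gridLabel.cell_subset (le_max_left _ _) ⟨z, hzq, hz⟩
  have hpq : ediam (cell gridLabel p) ^ t ≤ gauge t q.1 :=
    ENNReal.rpow_le_rpow (ediam_cell_le p) ht.le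
  refine hpq.trans (le_iInf fun f => le_iInf fun hf => le_iInf fun hcov => ?_)
  choose c hc hne using fun n => IsDyadicCube.exists_cell (hf n)
  have hlow : ∀ n, gauge t (max (c n).1 1) ≤ ediam (f n) ^ t := by
    intro n
    rw [hc n]
    exact ENNReal.rpow_le_rpow (le_ediam_cell hd (hne n)) ht.le
  by_cases h0 : ∃ n, (c n).1 = 0
  · obtain ⟨n, hn⟩ := h0
    refine le_trans ?_ ((hlow n).trans (ENNReal.le_tsum n))
    refine gauge_antitone ht.le ?_
    rw [hn]
    exact le_max_right _ _
  · push Not at h0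
    refine (hE q (range c) ⟨z, hzq⟩ ?_).trans ?_
    · rintro y ⟨hyE, hyq⟩
      obtain ⟨n, hn⟩ := mem_iUnion.1 (hcov ⟨hyE, hqp hyq⟩)
      exact mem_iUnion₂.2 ⟨c n, mem_range_self n, hc n ▸ hn⟩
    · refine (ENNReal.tsum_le_tsum_comp_of_surjective (rangeFactorization_surjective (f := c))
        fun c => gauge t c.1.1).trans (ENNReal.tsum_le_tsum fun n => ?_)
      have h1 := hlow n
      rwa [max_eq_left (Nat.one_le_iff_ne_zero.2 (h0 n))] at h1

lemma exists_gauge_le (ht : 0 < t) {η : ℝ≥0∞} (hη : 0 < η) : ∃ n, gauge t n ≤ η := by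
  have h1 : Tendsto (fun n : ℕ => ENNReal.ofReal ((1 / 2) ^ n) ^ t) atTop (𝓝 0) := by
    have h2 := (ENNReal.tendsto_ofReal (tendsto_pow_atTop_nhds_zero_of_lt_one
      (r := (1 / 2 : ℝ)) (by norm_num) (by norm_num))).ennrpow_const t
    simpa [ENNReal.zero_rpow_of_pos ht] using h2
  exact (h1.eventually_le_const hη).exists

/-- A set of diameter at most `1` is covered by `3 ^ d` cells of comparable gauge. -/
lemma exists_cells_cover (ht : 0 < t) (A : Set (Torus d)) (hA : ediam A ≤ 1) {η : ℝ≥0∞}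
    (hη : 0 < η) :
    ∃ (n : ℕ) (κ : (Fin d → Fin 3) → (Fin d → ℤ)), (A ⊆ ⋃ e, cell gridLabel (n, κ e)) ∧
      gauge t n ≤ 2 ^ t * (⨆ _ : A.Nonempty, ediam A ^ t) + η := by
  obtain ⟨n₀, hn₀⟩ := exists_gauge_le ht hη
  rcases A.eq_empty_or_nonempty with rfl | hne
  · exact ⟨n₀, 0, empty_subset _, hn₀.trans le_add_self⟩
  obtain ⟨n, hn, hgn⟩ : ∃ n : ℕ, ediam A ≤ ENNReal.ofReal ((1 / 2) ^ n) ∧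
      gauge t n ≤ 2 ^ t * ediam A ^ t + η := by
    rcases eq_or_ne (ediam A) 0 with h0 | h0
    · exact ⟨n₀, h0 ▸ zero_le, hn₀.trans le_add_self⟩
    have htop : ediam A ≠ ⊤ := ne_top_of_le_ne_top ENNReal.one_ne_top hA
    obtain ⟨n, hn1, hn2⟩ := exists_nat_pow_near_of_lt_one (x := (ediam A).toReal) (y := 1 / 2)
      (ENNReal.toReal_pos h0 htop) (by simpa using ENNReal.toReal_mono ENNReal.one_ne_top hA)
      (by norm_num) (by norm_num)
    refine ⟨n, ENNReal.le_ofReal_iff_toReal_le htop (by positivity) |>.2 hn2, ?_⟩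
    rw [gauge_eq_mul_succ ht.le]
    refine le_add_right (mul_le_mul_right (ENNReal.rpow_le_rpow ?_ ht.le) _)
    exact ENNReal.ofReal_le_of_le_toReal hn1.le
  obtain ⟨x, hx⟩ := hne
  obtain ⟨κ, hκ⟩ := exists_label_family n x
  refine ⟨n, κ, fun y hy => mem_iUnion.2 (hκ y ?_), ?_⟩
  · have h1 := (edist_le_ediam_of_mem hy hx).trans hn
    rwa [edist_dist, ENNReal.ofReal_le_ofReal_iff (by positivity)] at h1
  · rwa [iSup_pos ⟨x, hx⟩]

lemma HasFullContent.hausdorffMeasure_ne_zero (hE : HasFullContent E t) (ht : 0 < t) :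
    Measure.hausdorffMeasure t E ≠ 0 := by
  intro h0
  rw [Measure.hausdorffMeasure_apply, ENNReal.iSup_eq_zero] at h0
  have h1 := h0 1
  rw [iSup_pos one_pos] at h1
  have hK : (3 : ℝ≥0∞) ^ d * (2 ^ t + 1) ≠ ⊤ := by finiteness
  obtain ⟨κ, hκ0, hκ⟩ := ENNReal.exists_nnreal_pos_mul_lt hK (gauge_ne_zero (t := t) 1)
  have hκ0' : (0 : ℝ≥0∞) < κ := by exact_mod_cast hκ0
  rw [← h1] at hκ0'
  simp only [iInf_lt_iff] at hκ0'
  obtain ⟨A, hcov, hA, hsum⟩ := hκ0'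
  obtain ⟨η, hη, hηsum⟩ := ENNReal.exists_pos_sum_of_countable' (ε := κ)
    (by exact_mod_cast hκ0.ne') ℕ
  choose n lab hlab hg using fun k => exists_cells_cover ht (A k) (hA k) (hη k)
  set F : ℕ × (Fin d → Fin 3) → ℕ × (Fin d → ℤ) := fun k => (n k.1, lab k.1 k.2)
  have h2 := hE (1, gridLabel 1 0) (range F) ⟨0, rfl⟩ fun y hy => by
    obtain ⟨k, hk⟩ := mem_iUnion.1 (hcov hy.1)
    obtain ⟨e, he⟩ := mem_iUnion.1 (hlab k hk)
    exact mem_iUnion₂.2 ⟨F (k, e), mem_range_self _, he⟩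
  have h3 : ∑' c : range F, gauge t c.1.1 < gauge t 1 := by
    calc ∑' c : range F, gauge t c.1.1 ≤ ∑' k, gauge t (F k).1 :=
          ENNReal.tsum_le_tsum_comp_of_surjective (rangeFactorization_surjective (f := F))
            fun c => gauge t c.1.1
      _ = ∑' k, 3 ^ d * gauge t (n k) := by
          rw [ENNReal.tsum_prod']
          simp [F, tsum_fintype]
      _ ≤ ∑' k, 3 ^ d * (2 ^ t * (⨆ _ : (A k).Nonempty, ediam (A k) ^ t) + η k) := by
          gcongr with k
          exact hg k
      _ = 3 ^ d * (2 ^ t * (∑' k, ⨆ _ : (A k).Nonempty, ediam (A k) ^ t) + ∑' k, η k) := by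
          rw [ENNReal.tsum_mul_left, ENNReal.tsum_add, ENNReal.tsum_mul_left]
      _ ≤ 3 ^ d * (2 ^ t * κ + κ) := by gcongr
      _ = κ * (3 ^ d * (2 ^ t + 1)) := by ring
      _ < gauge t 1 := hκ
  exact (h2.trans_lt h3).false

lemma HasFullContent.le_dimH {t : NNReal} (hE : HasFullContent E t) (ht : 0 < t) :
    (t : ℝ≥0∞) ≤ dimH E :=
  le_dimH_of_hausdorffMeasure_ne_zero (hE.hausdorffMeasure_ne_zero ht)

end Conclusion

end MassTransference

/-- **Corollary (mass transference for ellipsoids).** If `limsup B(x_j,r_j)` has full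
measure, the `U_j ⊆ B(x_j,r_j)` are open ellipsoids, and
`s = sup{ t ∈ (0,d] : sup_j λ(B(x_j,r_j)) / φ^t(U_j) < ∞ }`, then
`dim_H (limsup U_j) ≥ s` and `limsup U_j ∈ 𝒢^s(𝕋^d)`. -/
theorem mass_transference_ellipsoids
    (d : ℕ) (hd : 0 < d)
    (x : ℕ → Torus d) (r : ℕ → ℝ) (hr : ∀ j, 0 < r j)
    (hrlim : Tendsto r atTop (𝓝 0))
    (hfull : volume ((⋂ k, ⋃ j, ⋃ (_ : k ≤ j), ball (x j) (r j))ᶜ) = 0)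
    (U : ℕ → Set (Torus d)) (a : ℕ → Fin d → ℝ)
    (hell : ∀ j, IsEllipsoidWithSemiaxes (U j) (a j))
    (hUB : ∀ j, U j ⊆ ball (x j) (r j))
    (s : ℝ)
    (hs : s = sSup {t : ℝ | 0 < t ∧ t ≤ d ∧
      (⨆ j, volume (ball (x j) (r j)) /
        ENNReal.ofReal (singularValueFunction (a j) t)) < ⊤}) :
    ENNReal.ofReal s ≤ dimH (⋂ k, ⋃ j, ⋃ (_ : k ≤ j), U j) ∧
      MemLargeIntersectionClass s (⋂ k, ⋃ j, ⋃ (_ : k ≤ j), U j) := by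
  have hcontent : ∀ t, 0 < t → t < s →
      MassTransference.HasFullContent (⋂ k, ⋃ j, ⋃ (_ : k ≤ j), U j) t := by
    intro t ht hts
    rw [hs] at hts
    obtain ⟨t', ⟨-, ht'd, hC⟩, htt'⟩ := exists_lt_of_lt_csSup (by
      by_contra h
      rw [Set.not_nonempty_iff_eq_empty.1 h, Real.sSup_empty] at hts
      exact lt_asymm ht hts) hts
    refine MassTransference.hasFullContent_limsup hd hr hrlim hfull hell hUB ht htt' ht'd hC.ne
      fun j => ?_
    have hpos := MassTransference.singularValueFunction_pos (t := t') (hell j).1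
    rw [← ENNReal.div_le_iff (by simpa using hpos) ENNReal.ofReal_ne_top]
    exact le_iSup (fun j => volume (ball (x j) (r j)) /
      ENNReal.ofReal (singularValueFunction (a j) t')) j
  refine ⟨ENNReal.le_of_forall_nnreal_lt fun t hts => ?_, ?_, fun D hD t hts => ?_⟩
  · rcases eq_zero_or_pos t with rfl | ht
    · simp
    · rw [← ENNReal.ofReal_coe_nnreal] at hts
      exact (hcontent t ht ((ENNReal.ofReal_lt_ofReal_iff_of_nonneg t.2).1 hts)).le_dimH ht
  · exact IsGδ.iInter_of_isOpen fun k => isOpen_iUnion fun j => isOpen_iUnion fun _ =>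
      MassTransference.IsEllipsoidWithSemiaxes.isOpen (hell j)
  · rcases le_or_gt t 0 with ht | ht
    · rw [MassTransference.dyadicContent_eq_top_of_nonpos ht]
      exact le_top
    · exact (hcontent t ht hts).ediam_rpow_le_dyadicContent hd ht hD
end
end

section
/- Let (B(x_j,r_j))_{j=1}^∞ be balls in 𝕋^d with r_j → 0 such that limsup_{j→∞} B(x_j,r_j) has full Lebesgue measure, and suppose that the sets U_j ⊂ B(x_j,r_j) are open rectangles (axis-parallel or rotated boxes). Set s = sup{ t : sup_j λ(B(x_j,r_j))/φ^t(U_j) < ∞ }, where for a rectangle U with side lengths λ_1 ≥ λ_2 ≥ … ≥ λ_d and m < t ≤ m+1 one puts φ^t(U) = λ_1⋯λ_m·λ_{m+1}^{t−m}. Then dim_H limsup_{j→∞} U_j ≥ s and limsup_{j→∞} U_j ∈ 𝒢^s(𝕋^d). -/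
open MeasureTheory Metric Filter Set
open scoped ENNReal Topology

noncomputable section

/-- `U ⊆ 𝕋^d` is an (open, possibly rotated) rectangle with side lengths
`a 0 ≥ a 1 ≥ … ≥ a (d-1) > 0`: it is the image under the projection `ℝ^d → 𝕋^d` of an
open rectangular box of diameter `< 1` in `ℝ^d`, with orthonormal frame `v`. -/
def IsRectangleWithSides {d : ℕ} (U : Set (Torus d)) (a : Fin d → ℝ) : Prop :=
  (∀ i, 0 < a i) ∧ (∀ i j : Fin d, i ≤ j → a j ≤ a i) ∧
  ∃ (c : Fin d → ℝ) (v : Fin d → Fin d → ℝ),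
    (∀ i j : Fin d, ∑ l, v i l * v j l = if i = j then 1 else 0) ∧
    Metric.diam {y : Fin d → ℝ | ∀ i, |∑ l, (y l - c l) * v i l| < a i / 2} < 1 ∧
    U = torusProj '' {y : Fin d → ℝ | ∀ i, |∑ l, (y l - c l) * v i l| < a i / 2}


section TorusGeometry

variable {d : ℕ}

theorem volume_torus_closedBall (y : Torus d) {ρ : ℝ} (hρ : 0 ≤ ρ) :
    volume (closedBall y ρ) = ENNReal.ofReal (min 1 (2 * ρ)) ^ d := by
  rw [closedBall_pi _ hρ, volume_pi_pi]
  simp [AddCircle.volume_closedBall]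

theorem volume_torus_ball (y : Torus d) {ρ : ℝ} (hρ : 0 < ρ) :
    volume (ball y ρ) = ENNReal.ofReal (min 1 (2 * ρ)) ^ d := by
  rw [ball_pi _ hρ, volume_pi_pi]
  have h : ∀ z : AddCircle (1 : ℝ), volume (ball z ρ) = ENNReal.ofReal (min 1 (2 * ρ)) := fun z => by
    rw [← AddCircle.volume_closedBall 1 (x := z) ρ]
    exact (measure_congr AddCircle.closedBall_ae_eq_ball).symm
  simp [h]

theorem volume_torus_ball_of_le_half (y : Torus d) {ρ : ℝ} (hρ : 0 < ρ) (h : ρ ≤ 1 / 2) :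
    volume (ball y ρ) = ENNReal.ofReal ((2 * ρ) ^ d) := by
  rw [volume_torus_ball y hρ, min_eq_right (by linarith), ENNReal.ofReal_pow (by linarith)]

theorem volume_torus_ball_le (y : Torus d) {ρ : ℝ} (hρ : 0 < ρ) :
    volume (ball y ρ) ≤ ENNReal.ofReal ((2 * ρ) ^ d) := by
  rw [volume_torus_ball y hρ, ENNReal.ofReal_pow (by linarith)]
  gcongr
  exact min_le_right _ _

theorem volume_torus_closedBall_le (y : Torus d) {ρ : ℝ} (hρ : 0 ≤ ρ) :
    volume (closedBall y ρ) ≤ ENNReal.ofReal ((2 * ρ) ^ d) := by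
  rw [volume_torus_closedBall y hρ, ENNReal.ofReal_pow (by linarith)]
  gcongr
  exact min_le_right _ _

theorem isOpenMap_torusProj : IsOpenMap (torusProj (d := d)) := by
  have := IsOpenMap.piMap (f := fun (_ : Fin d) (t : ℝ) => (t : AddCircle (1 : ℝ)))
    (fun _ => QuotientAddGroup.isOpenMap_coe) (by simp [Filter.cofinite_eq_bot])
  exact this

theorem continuous_torusProj : Continuous (torusProj (d := d)) :=
  continuous_pi fun i => (AddCircle.continuous_mk' (1 : ℝ)).comp (continuous_apply i)

theorem measurePreserving_torusProj (b : Fin d → ℝ) :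
    MeasurePreserving (torusProj (d := d))
      (volume.restrict (Set.univ.pi fun i => Set.Ioc (b i) (b i + 1))) volume := by
  have h := measurePreserving_pi _ _ (fun i => AddCircle.measurePreserving_mk 1 (b i))
  rw [← Measure.restrict_pi_pi] at h
  exact h

theorem exists_lift_dist (x y : AddCircle (1 : ℝ)) :
    ∃ u : ℝ, |u| = dist x y ∧ (u : AddCircle (1 : ℝ)) = x - y := by
  obtain ⟨v, hv⟩ := QuotientAddGroup.mk_surjective (x - y)
  refine ⟨v - round v, ?_, ?_⟩
  · rw [dist_eq_norm, ← hv]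
    exact (UnitAddCircle.norm_eq (x := v)).symm
  · rw [← hv]
    have : ((round v : ℝ) : AddCircle (1 : ℝ)) = 0 := by
      rw [AddCircle.coe_eq_zero_iff]
      exact ⟨round v, by simp⟩
    rw [AddCircle.coe_sub, this, sub_zero]

theorem norm_coe_le_abs (w : ℝ) : ‖(w : AddCircle (1 : ℝ))‖ ≤ |w| := by
  rw [UnitAddCircle.norm_eq]
  simpa using round_le w 0

theorem exists_ball_subset_inter {y p : Torus d} {r ρ : ℝ} (hr : 0 < r) (hrρ : r ≤ ρ)
    (hp : p ∈ ball y ρ) : ∃ q, ball q (r / 2) ⊆ ball y ρ ∩ ball p r := by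
  choose u hu hu' using fun i => exists_lift_dist (p i) (y i)
  have hρ : 0 < ρ := hr.trans_le hrρ
  have hlt : ∀ i, |u i| < ρ := fun i => (hu i).trans_lt ((dist_le_pi_dist p y i).trans_lt hp)
  have hrr : r / (2 * ρ) ≤ 1 := by rw [div_le_one (by positivity)]; linarith
  set τ := r / (2 * ρ) with hτ
  have hτ0 : 0 < τ := by positivity
  have hτρ : τ * ρ = r / 2 := by rw [hτ]; field_simp
  refine ⟨fun i => y i + (((1 - τ) * u i : ℝ) : AddCircle (1 : ℝ)), ?_⟩
  set q : Torus d := fun i => y i + (((1 - τ) * u i : ℝ) : AddCircle (1 : ℝ)) with hq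
  have h1 : dist q y ≤ ρ - r / 2 := by
    rw [dist_pi_le_iff (by linarith)]
    intro i
    rw [dist_eq_norm, hq]
    simp only [add_sub_cancel_left]
    refine (norm_coe_le_abs _).trans ?_
    rw [abs_mul, abs_of_nonneg (by linarith : 0 ≤ 1 - τ)]
    nlinarith [hlt i, abs_nonneg (u i)]
  have h2 : dist q p ≤ r / 2 := by
    rw [dist_pi_le_iff (by linarith)]
    intro i
    have : q i - p i = ((-(τ * u i) : ℝ) : AddCircle (1 : ℝ)) := by
      have h3 : p i = y i + (u i : AddCircle (1 : ℝ)) := by rw [hu' i]; abel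
      rw [hq, h3]
      simp only [add_sub_add_left_eq_sub]
      rw [← AddCircle.coe_sub]
      congr 1
      ring
    rw [dist_eq_norm, this]
    refine (norm_coe_le_abs _).trans ?_
    rw [abs_neg, abs_mul, abs_of_nonneg hτ0.le]
    nlinarith [hlt i, abs_nonneg (u i)]
  refine subset_inter (ball_subset_ball' (by linarith)) (ball_subset_ball' (by linarith))

end TorusGeometry

section Boxes

variable {d : ℕ}

/-- The open box with centre `c`, frame `v` and side lengths `a`. -/
def orientedBox (c : Fin d → ℝ) (v : Fin d → Fin d → ℝ) (a : Fin d → ℝ) : Set (Fin d → ℝ) :=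
  {y | ∀ i, |∑ l, (y l - c l) * v i l| < a i / 2}

theorem isOpen_orientedBox (c : Fin d → ℝ) (v : Fin d → Fin d → ℝ) (a : Fin d → ℝ) :
    IsOpen (orientedBox c v a) := by
  have : orientedBox c v a = ⋂ i, {y | |∑ l, (y l - c l) * v i l| < a i / 2} := by
    ext y; simp [orientedBox]
  rw [this]
  exact isOpen_iInter_of_finite fun i => isOpen_lt (by fun_prop) continuous_const

theorem IsRectangleWithSides.isOpen {U : Set (Torus d)} {a : Fin d → ℝ}
    (h : IsRectangleWithSides U a) : IsOpen U := by
  obtain ⟨_, _, c, v, _, _, rfl⟩ := h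
  exact isOpenMap_torusProj _ (isOpen_orientedBox c v a)

theorem abs_le_one_of_orthonormal {v : Fin d → Fin d → ℝ}
    (hv : ∀ i j : Fin d, ∑ l, v i l * v j l = if i = j then 1 else 0) (i l : Fin d) :
    |v i l| ≤ 1 := by
  have h := hv i i
  rw [if_pos rfl] at h
  have : v i l * v i l ≤ 1 := h ▸ Finset.single_le_sum (f := fun l => v i l * v i l)
    (fun l _ => mul_self_nonneg _) (Finset.mem_univ l)
  exact abs_le_one_iff_mul_self_le_one.2 this

theorem matrix_mul_transpose_eq_one {v : Fin d → Fin d → ℝ}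
    (hv : ∀ i j : Fin d, ∑ l, v i l * v j l = if i = j then 1 else 0) :
    Matrix.of v * (Matrix.of v).transpose = 1 := by
  ext i j
  rw [Matrix.mul_apply, Matrix.one_apply, ← hv i j]
  rfl

theorem measurePreserving_frame {v : Fin d → Fin d → ℝ}
    (hv : ∀ i j : Fin d, ∑ l, v i l * v j l = if i = j then 1 else 0) :
    MeasurePreserving (fun (y : Fin d → ℝ) i => ∑ l, y l * v i l) volume volume := by
  have hM := matrix_mul_transpose_eq_one hv
  have hdet : (Matrix.of v).det * (Matrix.of v).det = 1 := by
    have := congrArg Matrix.det hM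
    rwa [Matrix.det_mul, Matrix.det_transpose, Matrix.det_one] at this
  have hne : (Matrix.of v).det ≠ 0 := by
    intro h; rw [h] at hdet; simp at hdet
  have habs : |(Matrix.of v).det⁻¹| = 1 := by
    rw [abs_inv, inv_eq_one]
    rcases mul_self_eq_one_iff.1 hdet with h | h <;> simp [h]
  have heq : (fun (y : Fin d → ℝ) i => ∑ l, y l * v i l) = ⇑(Matrix.toLin' (Matrix.of v)) := by
    ext y i
    simp [Matrix.toLin'_apply, Matrix.mulVec, dotProduct, mul_comm]
  refine ⟨by fun_prop, ?_⟩
  rw [heq, Real.map_matrix_volume_pi_eq_smul_volume_pi hne, habs]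
  simp

theorem volume_orientedBox {c : Fin d → ℝ} {v : Fin d → Fin d → ℝ} {a : Fin d → ℝ}
    (hv : ∀ i j : Fin d, ∑ l, v i l * v j l = if i = j then 1 else 0) :
    volume (orientedBox c v a) = ∏ i, ENNReal.ofReal (a i) := by
  have hbox : orientedBox c v a = (fun (y : Fin d → ℝ) i => ∑ l, y l * v i l) ⁻¹'
      Set.univ.pi fun i => ball (∑ l, c l * v i l) (a i / 2) := by
    ext y
    simp [orientedBox, Real.dist_eq, sub_mul]
  rw [hbox, (measurePreserving_frame hv).measure_preimage
    (MeasurableSet.univ_pi fun i => measurableSet_ball).nullMeasurableSet, volume_pi_pi]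
  refine Finset.prod_congr rfl fun i _ => ?_
  rw [Real.volume_ball]
  congr 1
  ring

theorem volume_orientedBox_inter_ball_le {c : Fin d → ℝ} {v : Fin d → Fin d → ℝ} {a : Fin d → ℝ}
    (hv : ∀ i j : Fin d, ∑ l, v i l * v j l = if i = j then 1 else 0) (z : Fin d → ℝ) (ρ : ℝ) :
    volume (orientedBox c v a ∩ ball z ρ) ≤
      ∏ i, ENNReal.ofReal (min (a i) (2 * d * ρ)) := by
  have hsub : orientedBox c v a ∩ ball z ρ ⊆ (fun (y : Fin d → ℝ) i => ∑ l, y l * v i l) ⁻¹'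
      Set.univ.pi fun i => ball (∑ l, c l * v i l) (a i / 2) ∩
        closedBall (∑ l, z l * v i l) (d * ρ) := by
    rintro y ⟨hy, hyz⟩ i -
    refine ⟨?_, ?_⟩
    · simpa [Real.dist_eq, sub_mul] using hy i
    · simp only [mem_closedBall, Real.dist_eq]
      rw [← Finset.sum_sub_distrib]
      refine (Finset.abs_sum_le_sum_abs _ _).trans ?_
      have : ∀ l ∈ (Finset.univ : Finset (Fin d)), |y l * v i l - z l * v i l| ≤ ρ := fun l _ => by
        rw [← sub_mul, abs_mul]
        have h1 : |y l - z l| ≤ ρ := by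
          rw [← Real.dist_eq]; exact (dist_le_pi_dist y z l).trans (mem_ball.1 hyz).le
        calc |y l - z l| * |v i l| ≤ |y l - z l| * 1 := by
              gcongr; exact abs_le_one_of_orthonormal hv i l
          _ ≤ ρ := by rwa [mul_one]
      simpa using Finset.sum_le_sum this
  refine (measure_mono hsub).trans ?_
  rw [(measurePreserving_frame hv).measure_preimage
    (MeasurableSet.univ_pi fun i =>
      measurableSet_ball.inter measurableSet_closedBall).nullMeasurableSet, volume_pi_pi]
  refine Finset.prod_le_prod' fun i _ => ?_
  rw [ENNReal.ofReal_min]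
  refine le_min ((measure_mono inter_subset_left).trans ?_)
    ((measure_mono inter_subset_right).trans ?_)
  · rw [Real.volume_ball]
    exact ENNReal.ofReal_le_ofReal (by linarith)
  · rw [Real.volume_closedBall]
    exact ENNReal.ofReal_le_ofReal (by linarith)

theorem orientedBox_subset_Ioc {c : Fin d → ℝ} {v : Fin d → Fin d → ℝ} {a : Fin d → ℝ}
    (hv : ∀ i j : Fin d, ∑ l, v i l * v j l = if i = j then 1 else 0)
    (hdiam : Metric.diam (orientedBox c v a) < 1) :
    orientedBox c v a ⊆ Set.univ.pi fun i => Set.Ioc (c i - 1 / 2) (c i - 1 / 2 + 1) := by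
  have hM := mul_eq_one_comm.1 (matrix_mul_transpose_eq_one hv)
  have hbdd : Bornology.IsBounded (orientedBox c v a) := by
    refine (isBounded_closedBall (x := c) (r := ∑ i, |a i| / 2)).subset fun y hy => ?_
    rw [mem_closedBall, dist_pi_le_iff (by positivity)]
    intro l
    have h1 : y l - c l = ∑ i, v i l * ∑ k, (y k - c k) * v i k := by
      have := congrFun (congrArg (fun N : Matrix (Fin d) (Fin d) ℝ => N.mulVec (y - c)) hM) l
      simp only [← Matrix.mulVec_mulVec, Matrix.one_mulVec] at this
      rw [← Pi.sub_apply, ← this]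
      simp [Matrix.mulVec, dotProduct, mul_comm]
    rw [Real.dist_eq, h1]
    refine (Finset.abs_sum_le_sum_abs _ _).trans (Finset.sum_le_sum fun i _ => ?_)
    rw [abs_mul]
    calc |v i l| * |∑ k, (y k - c k) * v i k| ≤ 1 * (a i / 2) := by
          gcongr
          · exact abs_le_one_of_orthonormal hv i l
          · exact (hy i).le
      _ ≤ |a i| / 2 := by rw [one_mul]; gcongr; exact le_abs_self _
  intro y hy i _
  have hy' : (2 : ℝ) • c - y ∈ orientedBox c v a := fun j => by
    have : ∑ l, (((2 : ℝ) • c - y) l - c l) * v j l = -∑ l, (y l - c l) * v j l := by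
      rw [← Finset.sum_neg_distrib]
      refine Finset.sum_congr rfl fun l _ => ?_
      simp only [Pi.sub_apply, Pi.smul_apply, smul_eq_mul]
      ring
    rw [this, abs_neg]
    exact hy j
  have h := ((dist_le_pi_dist _ _ i).trans (dist_le_diam_of_mem hbdd hy hy')).trans_lt hdiam
  rw [Real.dist_eq] at h
  simp only [Pi.sub_apply, Pi.smul_apply, smul_eq_mul] at h
  obtain ⟨h1, h2⟩ := abs_lt.1 h
  constructor <;> linarith

theorem inter_preimage_ball_subset {b : Fin d → ℝ} (w : Torus d) (ρ : ℝ) :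
    ∃ z : Fin d → ℝ, (Set.univ.pi fun i => Set.Ioc (b i) (b i + 1)) ∩ torusProj ⁻¹' ball w ρ ⊆
      ⋃ e : Fin d → Fin 3, ball (fun i => z i + ((e i : ℕ) - 1 : ℝ)) ρ := by
  have hz : ∀ i, ∃ z ∈ Set.Ioc (b i) (b i + 1), (z : AddCircle (1 : ℝ)) = w i := fun i => by
    have := (AddCircle.coe_image_Ioc_eq (1 : ℝ) (b i)).symm ▸ Set.mem_univ (w i)
    exact this
  choose z hz hzw using hz
  refine ⟨z, ?_⟩
  rintro y ⟨hyb, hyw⟩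
  have hρ : 0 < ρ := dist_nonneg.trans_lt hyw
  rw [mem_preimage, mem_ball, dist_pi_lt_iff hρ] at hyw
  have key : ∀ i, ∃ e : Fin 3, |y i - (z i + ((e : ℕ) - 1 : ℝ))| < ρ := fun i => by
    have h := hyw i
    rw [dist_eq_norm, ← hzw i, torusProj, ← AddCircle.coe_sub, UnitAddCircle.norm_eq] at h
    have h1 := abs_lt.1 (show |y i - z i| < 1 by
      have h1 := hyb i trivial
      have h2 := hz i
      rw [abs_lt]; constructor <;> linarith [h1.1, h1.2, h2.1, h2.2])
    have h2 := abs_le.1 (abs_sub_round (y i - z i))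
    set m := round (y i - z i)
    have hm1 : (m : ℝ) < 2 := by linarith [h1.2, h2.1]
    have hm2 : (-2 : ℝ) < m := by linarith [h1.1, h2.2]
    have hm1' : m < 2 := by exact_mod_cast hm1
    have hm2' : -2 < m := by exact_mod_cast hm2
    have hm : m = -1 ∨ m = 0 ∨ m = 1 := by omega
    rcases hm with hm | hm | hm <;> rw [hm] at h
    · refine ⟨0, ?_⟩; convert h using 2; push_cast; simp; ring
    · refine ⟨1, ?_⟩; convert h using 2; push_cast; simp
    · refine ⟨2, ?_⟩; convert h using 2; push_cast; simp; ring
  choose e he using key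
  refine mem_iUnion.2 ⟨e, ?_⟩
  rw [mem_ball, dist_pi_lt_iff hρ]
  exact he

theorem singularValueFunction_pos {a : Fin d → ℝ} (ha : ∀ i, 0 < a i) (t : ℝ) :
    0 < singularValueFunction a t := by
  unfold singularValueFunction
  refine mul_pos (Finset.prod_pos fun i _ => ha i) (Real.rpow_pos_of_pos ?_ _)
  split_ifs
  · exact ha _
  · exact one_pos

theorem prod_min_mul_singularValueFunction_le {a : Fin d → ℝ} (ha : ∀ i, 0 < a i)
    {t K : ℝ} (ht : 0 < t) (htd : t ≤ d) (hK : 0 < K) :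
    (∏ i, min (a i) K) * singularValueFunction a t ≤ K ^ t * ∏ i, a i := by
  set m := ⌈t⌉₊ - 1 with hm
  have hceil : 0 < ⌈t⌉₊ := Nat.ceil_pos.2 ht
  have hmd : m < d := by
    have : ⌈t⌉₊ ≤ d := Nat.ceil_le.2 htd
    omega
  have hmc : (m : ℝ) + 1 = ⌈t⌉₊ := by rw [hm]; push_cast [Nat.cast_sub hceil]; ring
  have hmt : (m : ℝ) < t := by linarith [Nat.ceil_lt_add_one ht.le]
  have htm : t ≤ m + 1 := hmc ▸ Nat.le_ceil t
  have hsv : singularValueFunction a t =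
      (∏ i ∈ Finset.univ.filter (fun i : Fin d => (i : ℕ) < m), a i) *
        a ⟨m, hmd⟩ ^ (t - m) := by
    simp only [singularValueFunction, ← hm, dif_pos hmd]
  set k : Fin d := ⟨m, hmd⟩
  set S : Finset (Fin d) := Finset.univ.filter (fun i : Fin d => (i : ℕ) < m)
  have hS : S.card = m := by
    have : S = Finset.Iio k := by ext i; simp [S, k, Fin.lt_def]
    rw [this, Fin.card_Iio]
  have hkS : k ∉ S := by simp [S, k]
  have hsplit : ∀ f : Fin d → ℝ, ∏ i, f i = (∏ i ∈ S, f i) * (f k * ∏ i ∈ Sᶜ.erase k, f i) :=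
    fun f => by
      rw [Finset.mul_prod_erase _ _ (by simpa using hkS), Finset.prod_mul_prod_compl]
  have hmin : ∀ i, 0 < min (a i) K := fun i => lt_min (ha i) hK
  have h1 : ∏ i ∈ S, min (a i) K ≤ K ^ m := by
    rw [← hS, ← Finset.prod_const]
    exact Finset.prod_le_prod (fun i _ => (hmin i).le) fun i _ => min_le_right _ _
  have h2 : min (a k) K ≤ K ^ (t - m) * a k ^ (1 - (t - m)) := by
    calc min (a k) K = min (a k) K ^ (t - m) * min (a k) K ^ (1 - (t - m)) := by
          rw [← Real.rpow_add (hmin k)]; simp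
      _ ≤ _ := mul_le_mul
          (Real.rpow_le_rpow (hmin k).le (min_le_right _ _) (by linarith))
          (Real.rpow_le_rpow (hmin k).le (min_le_left _ _) (by linarith))
          (Real.rpow_nonneg (hmin k).le _) (Real.rpow_nonneg hK.le _)
  have h3 : ∏ i ∈ Sᶜ.erase k, min (a i) K ≤ ∏ i ∈ Sᶜ.erase k, a i :=
    Finset.prod_le_prod (fun i _ => (hmin i).le) fun i _ => min_le_left _ _
  have hp : ∀ T : Finset (Fin d), 0 < ∏ i ∈ T, a i := fun T => Finset.prod_pos fun i _ => ha i
  have hp' : ∀ T : Finset (Fin d), 0 < ∏ i ∈ T, min (a i) K :=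
    fun T => Finset.prod_pos fun i _ => hmin i
  rw [hsv, hsplit, hsplit a]
  calc (∏ i ∈ S, min (a i) K) * (min (a k) K * ∏ i ∈ Sᶜ.erase k, min (a i) K) *
        ((∏ i ∈ S, a i) * a k ^ (t - m))
      ≤ K ^ m * (K ^ (t - m) * a k ^ (1 - (t - m)) * ∏ i ∈ Sᶜ.erase k, a i) *
        ((∏ i ∈ S, a i) * a k ^ (t - m)) := by
        have := hp S
        have := hp' S
        have := hp (Sᶜ.erase k)
        have := hp' (Sᶜ.erase k)
        have := hmin k
        have := ha k
        gcongr
    _ = (K ^ (m : ℝ) * K ^ (t - m)) * ((∏ i ∈ S, a i) *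
        ((a k ^ (1 - (t - m)) * a k ^ (t - m)) * ∏ i ∈ Sᶜ.erase k, a i)) := by
        rw [Real.rpow_natCast]; ring
    _ = _ := by
        rw [← Real.rpow_add hK, ← Real.rpow_add (ha k)]; simp

/-- Mass distribution principle for the normalised Lebesgue measure on a rectangle. -/
theorem IsRectangleWithSides.singularValueFunction_le_tsum (hd : 0 < d) {U : Set (Torus d)}
    {a : Fin d → ℝ} (hU : IsRectangleWithSides U a) {t : ℝ} (ht : 0 < t) (htd : t ≤ d)
    {w : ℕ → Torus d} {ρ : ℕ → ℝ} (hρ : ∀ n, 0 < ρ n)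
    (hcover : volume (U \ ⋃ n, ball (w n) (ρ n)) = 0) :
    ENNReal.ofReal (singularValueFunction a t) ≤ ENNReal.ofReal (3 ^ d * (2 * d) ^ t) *
      ∑' n, {n | (ball (w n) (ρ n) ∩ U).Nonempty}.indicator
        (fun n => ENNReal.ofReal (ρ n ^ t)) n := by
  have hUo := hU.isOpen
  obtain ⟨ha, -, c, v, hv, hdiam, hUeq⟩ := hU
  change Metric.diam (orientedBox c v a) < 1 at hdiam
  change U = torusProj '' orientedBox c v a at hUeq
  have hsub := orientedBox_subset_Ioc hv hdiam
  set I := Set.univ.pi fun i => Set.Ioc (c i - 1 / 2) (c i - 1 / 2 + 1)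
  set W : ℕ → Set (Torus d) := fun n => ball (w n) (ρ n) with hW
  have hWo : IsOpen (⋃ n, W n) := isOpen_iUnion fun n => isOpen_ball
  have hI : MeasurableSet I := MeasurableSet.univ_pi fun i => measurableSet_Ioc
  set P : ℝ := ∏ i, a i with hP
  have hP0 : 0 < P := Finset.prod_pos fun i _ => ha i
  have hd0 : (0 : ℝ) < d := by exact_mod_cast hd
  have hbox : volume (orientedBox c v a) = ENNReal.ofReal P := by
    rw [volume_orientedBox hv, hP, ENNReal.ofReal_prod_of_nonneg fun i _ => (ha i).le]
  have hnull : volume (orientedBox c v a \ torusProj ⁻¹' ⋃ n, W n) = 0 := by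
    have h := (measurePreserving_torusProj fun i => c i - 1 / 2).measure_preimage
      (hUo.measurableSet.diff hWo.measurableSet).nullMeasurableSet
    rw [hcover] at h
    rw [Measure.restrict_apply (continuous_torusProj.measurable
      (hUo.measurableSet.diff hWo.measurableSet))] at h
    refine measure_mono_null ?_ h
    rintro y ⟨hy, hyW⟩
    exact ⟨⟨hUeq ▸ mem_image_of_mem _ hy, hyW⟩, hsub hy⟩
  have hpiece : ∀ n, volume (orientedBox c v a ∩ torusProj ⁻¹' W n) *
      ENNReal.ofReal (singularValueFunction a t) ≤ ENNReal.ofReal P *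
      (ENNReal.ofReal (3 ^ d * (2 * d) ^ t) * {n | (W n ∩ U).Nonempty}.indicator
        (fun n => ENNReal.ofReal (ρ n ^ t)) n) := fun n => by
    by_cases hn : (W n ∩ U).Nonempty
    · rw [indicator_of_mem (show n ∈ {n | (W n ∩ U).Nonempty} from hn)]
      obtain ⟨z, hz⟩ := inter_preimage_ball_subset (b := fun i => c i - 1 / 2) (w n) (ρ n)
      have hle : volume (orientedBox c v a ∩ torusProj ⁻¹' W n) ≤
          ENNReal.ofReal (3 ^ d * ∏ i, min (a i) (2 * d * ρ n)) := by
        calc _ ≤ volume (⋃ e : Fin d → Fin 3,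
              orientedBox c v a ∩ ball (fun i => z i + ((e i : ℕ) - 1 : ℝ)) (ρ n)) := by
              refine measure_mono fun y hy => ?_
              rw [← inter_iUnion]
              exact ⟨hy.1, hz ⟨hsub hy.1, hy.2⟩⟩
          _ ≤ ∑ e : Fin d → Fin 3, volume
              (orientedBox c v a ∩ ball (fun i => z i + ((e i : ℕ) - 1 : ℝ)) (ρ n)) :=
              measure_iUnion_fintype_le _ _
          _ ≤ ∑ _e : Fin d → Fin 3, ∏ i, ENNReal.ofReal (min (a i) (2 * d * ρ n)) :=
              Finset.sum_le_sum fun e _ => volume_orientedBox_inter_ball_le hv _ _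
          _ = _ := by
              have : ∀ i ∈ (Finset.univ : Finset (Fin d)), 0 ≤ min (a i) (2 * d * ρ n) :=
                fun i _ => le_min (ha i).le (by have := hρ n; positivity)
              rw [ENNReal.ofReal_mul (by positivity), ENNReal.ofReal_prod_of_nonneg this,
                ENNReal.ofReal_pow (by norm_num)]
              simp
      calc _ ≤ ENNReal.ofReal (3 ^ d * ∏ i, min (a i) (2 * d * ρ n)) *
            ENNReal.ofReal (singularValueFunction a t) := by gcongr
        _ ≤ _ := by
          have hρn := hρ n
          have hK : 0 < 2 * d * ρ n := by positivity
          rw [← ENNReal.ofReal_mul' (singularValueFunction_pos ha t).le,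
            ← ENNReal.ofReal_mul (by positivity), ← ENNReal.ofReal_mul hP0.le]
          refine ENNReal.ofReal_le_ofReal ?_
          have := prod_min_mul_singularValueFunction_le ha ht htd hK
          rw [Real.mul_rpow (by positivity) hρn.le] at this
          rw [mul_assoc]
          calc _ ≤ 3 ^ d * ((2 * d) ^ t * ρ n ^ t * ∏ i, a i) := by gcongr
            _ = _ := by rw [← hP]; ring
    · have : orientedBox c v a ∩ torusProj ⁻¹' W n = ∅ := by
        rw [Set.eq_empty_iff_forall_notMem]
        rintro y ⟨hy, hyW⟩
        exact hn ⟨torusProj y, hyW, hUeq ▸ mem_image_of_mem _ hy⟩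
      rw [this]
      simp
  have htot : ENNReal.ofReal P ≤ ∑' n, volume (orientedBox c v a ∩ torusProj ⁻¹' W n) := by
    rw [← hbox]
    calc _ ≤ volume (orientedBox c v a ∩ torusProj ⁻¹' ⋃ n, W n) +
          volume (orientedBox c v a \ torusProj ⁻¹' ⋃ n, W n) := measure_le_inter_add_sdiff _ _ _
      _ = volume (⋃ n, orientedBox c v a ∩ torusProj ⁻¹' W n) := by
          rw [hnull, add_zero, preimage_iUnion, inter_iUnion]
      _ ≤ _ := measure_iUnion_le _
  have hPne : ENNReal.ofReal P ≠ 0 := by simpa using hP0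
  rw [← ENNReal.mul_le_mul_iff_right hPne ENNReal.ofReal_ne_top]
  calc ENNReal.ofReal P * ENNReal.ofReal (singularValueFunction a t)
      ≤ (∑' n, volume (orientedBox c v a ∩ torusProj ⁻¹' W n)) *
        ENNReal.ofReal (singularValueFunction a t) := by gcongr
    _ ≤ _ := by
      rw [← ENNReal.tsum_mul_right, ← ENNReal.tsum_mul_left, ← ENNReal.tsum_mul_left]
      exact ENNReal.tsum_le_tsum hpiece

end Boxes

section LimsupSets

variable {d : ℕ}

/-- Data of the mass transference principle at the exponent `t`: shrinking balls whose limsup set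
has full measure, and rectangles inside them whose singular value function dominates the volume of
the balls. -/
structure IsTransferenceSystem (x : ℕ → Torus d) (r : ℕ → ℝ) (U : ℕ → Set (Torus d))
    (a : ℕ → Fin d → ℝ) (t : ℝ) (C : ℝ≥0∞) : Prop where
  dim_pos : 0 < d
  radius_pos : ∀ j, 0 < r j
  tendsto_radius : Tendsto r atTop (𝓝 0)
  ae_mem : ∀ᵐ y : Torus d, y ∈ ⋂ k, ⋃ j, ⋃ (_ : k ≤ j), ball (x j) (r j)
  isRectangle : ∀ j, IsRectangleWithSides (U j) (a j)
  subset_ball : ∀ j, U j ⊆ ball (x j) (r j)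
  exponent_pos : 0 < t
  exponent_le : t ≤ d
  const_ne_top : C ≠ ⊤
  volume_ball_le : ∀ j, volume (ball (x j) (r j)) ≤
    C * ENNReal.ofReal (singularValueFunction (a j) t)

variable {x : ℕ → Torus d} {r : ℕ → ℝ} {U : ℕ → Set (Torus d)} {a : ℕ → Fin d → ℝ} {t : ℝ}
  {C : ℝ≥0∞} {w : ℕ → Torus d} {ρ : ℕ → ℝ} {O : Set (Torus d)}

/-- The tails of `⋃ U j` have positive measure in every open set minus a union of balls with finite
`t`-cost, as soon as that difference has positive measure. -/
theorem IsTransferenceSystem.volume_tail_inter_ne_zero (h : IsTransferenceSystem x r U a t C)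
    (hρ : ∀ n, 0 < ρ n) (hρ1 : ∀ n, ρ n ≤ 1) (hsum : ∑' n, ENNReal.ofReal (ρ n ^ t) ≠ ⊤)
    (hO : IsOpen O) (hpos : volume (O \ ⋃ n, ball (w n) (ρ n)) ≠ 0) (k : ℕ) :
    volume ((⋃ j, ⋃ (_ : k ≤ j), U j) ∩ (O \ ⋃ n, ball (w n) (ρ n))) ≠ 0 := by
  intro h0
  set W : ℕ → Set (Torus d) := fun n => ball (w n) (ρ n) with hW
  have hWm : ∀ n, MeasurableSet (W n) := fun n => measurableSet_ball
  set f : Torus d → ℝ≥0∞ := fun y =>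
    ∑' n, (W n).indicator (fun _ => ENNReal.ofReal (ρ n ^ (t - d))) y with hf
  have hfm : Measurable f := Measurable.ennreal_tsum fun n => measurable_const.indicator (hWm n)
  have hint : ∀ A : Set (Torus d), ∫⁻ y in A, f y =
      ∑' n, ENNReal.ofReal (ρ n ^ (t - d)) * volume (W n ∩ A) := fun A => by
    rw [hf, lintegral_tsum fun n => (measurable_const.indicator (hWm n)).aemeasurable]
    refine tsum_congr fun n => ?_
    rw [lintegral_indicator_const (hWm n), Measure.restrict_apply (hWm n)]
  have hweight : ∀ n, ρ n ^ (t - d) * (2 * ρ n) ^ d = 2 ^ d * ρ n ^ t := fun n => by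
    rw [mul_pow, mul_left_comm, ← Real.rpow_natCast (ρ n), ← Real.rpow_add (hρ n),
      sub_add_cancel]
  have hfin : ∫⁻ y, f y ≠ ⊤ := by
    rw [← setLIntegral_univ, hint]
    refine ne_top_of_le_ne_top (ENNReal.mul_ne_top (ENNReal.ofReal_ne_top (r := 2 ^ d)) hsum) ?_
    rw [← ENNReal.tsum_mul_left]
    refine ENNReal.tsum_le_tsum fun n => ?_
    rw [← ENNReal.ofReal_mul (by positivity), ← hweight,
      ENNReal.ofReal_mul (Real.rpow_nonneg (hρ n).le _), inter_univ]
    gcongr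
    exact volume_torus_ball_le _ (hρ n)
  have hdiff := (IsUnifLocDoublingMeasure.vitaliFamily (volume : Measure (Torus d))
    1).ae_tendsto_lintegral_div hfm.aemeasurable hfin
  obtain ⟨y, ⟨hyO, hyW⟩, hylim, hydiff⟩ :=
    ((frequently_ae_mem_iff.2 hpos).and_eventually (h.ae_mem.and hdiff)).exists
  have hfy : f y = 0 := by
    rw [hf, ENNReal.tsum_eq_zero]
    exact fun n => indicator_of_notMem (fun hn => hyW (mem_iUnion.2 ⟨n, hn⟩)) _
  rw [hfy] at hydiff
  have havg := hydiff.comp (IsUnifLocDoublingMeasure.tendsto_closedBall_filterAt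
    (volume : Measure (Torus d)) (K := 1) (x := y) (l := 𝓝[>] (0 : ℝ)) (fun _ => y) id tendsto_id
    (by filter_upwards [self_mem_nhdsWithin] with R hR
        simpa using (le_of_lt hR)))
  set C₁ : ℝ≥0∞ := ENNReal.ofReal (3 ^ d * (2 * d) ^ t) with hC₁
  set L : ℝ≥0∞ := ENNReal.ofReal (8 ^ d) * (C * C₁ + 1) with hL
  have hL0 : L ≠ 0 := by simp [hL]
  have hLtop : L ≠ ⊤ := ENNReal.mul_ne_top ENNReal.ofReal_ne_top
    (ENNReal.add_ne_top.2 ⟨ENNReal.mul_ne_top h.const_ne_top ENNReal.ofReal_ne_top, by simp⟩)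
  have hsmall := havg.eventually_lt_const (ENNReal.inv_pos.2 hLtop)
  obtain ⟨R₀, hR₀, hR⟩ := mem_nhdsGT_iff_exists_Ioo_subset.1 hsmall
  obtain ⟨ε, hε, hεO⟩ := Metric.isOpen_iff.1 hO y hyO
  have hR₀' : (0 : ℝ) < R₀ := hR₀
  obtain ⟨N, hN⟩ := eventually_atTop.1 (h.tendsto_radius.eventually_lt_const
    (show (0 : ℝ) < min (R₀ / 4) (min (ε / 2) (1 / 2)) by positivity))
  obtain ⟨j, hj⟩ := mem_iUnion.1 (mem_iInter.1 hylim (max N k))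
  obtain ⟨hjN, hyj⟩ := mem_iUnion.1 hj
  have hrj := hN j ((le_max_left _ _).trans hjN)
  have hkj : k ≤ j := (le_max_right _ _).trans hjN
  obtain ⟨hr1, hr2⟩ := lt_min_iff.1 hrj
  obtain ⟨hr2, hr3⟩ := lt_min_iff.1 hr2
  have hr0 := h.radius_pos j
  have hUy : U j ⊆ ball y (2 * r j) := fun p hp => by
    have h1 := h.subset_ball j hp
    rw [mem_ball] at h1 hyj ⊢
    linarith [dist_triangle_right p y (x j)]
  have hUO : U j ⊆ O := fun p hp => hεO (ball_subset_ball (by linarith) (hUy hp))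
  have hnull : volume (U j \ ⋃ n, W n) = 0 := by
    refine measure_mono_null (fun p hp => ?_) h0
    exact ⟨mem_iUnion₂.2 ⟨j, hkj, hp.1⟩, hUO hp.1, hp.2⟩
  set B := closedBall y (4 * r j) with hB
  have hlow : ENNReal.ofReal (r j ^ d) ≤ (C * C₁ + 1) * ∫⁻ z in B, f z := by
    rw [hint]
    by_cases hbig : ∃ n, (W n ∩ U j).Nonempty ∧ r j < ρ n
    · obtain ⟨n, ⟨p, hpW, hpU⟩, hn⟩ := hbig
      obtain ⟨q, hq⟩ := exists_ball_subset_inter hr0 hn.le hpW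
      have hqB : ball q (r j / 2) ⊆ W n ∩ B := fun z hz => ⟨(hq hz).1, by
        have h1 := (hq hz).2
        have h2 := hUy hpU
        rw [mem_ball] at h1 h2
        rw [hB, mem_closedBall]
        linarith [dist_triangle z p y]⟩
      calc ENNReal.ofReal (r j ^ d) = 1 * volume (ball q (r j / 2)) := by
            rw [volume_torus_ball_of_le_half q (by linarith) (by linarith), one_mul,
              mul_div_cancel₀ _ two_ne_zero]
        _ ≤ ENNReal.ofReal (ρ n ^ (t - d)) * volume (W n ∩ B) := by
            gcongr
            rw [ENNReal.one_le_ofReal]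
            exact Real.one_le_rpow_of_pos_of_le_one_of_nonpos (hρ n) (hρ1 n)
              (by linarith [h.exponent_le])
        _ ≤ _ := ENNReal.le_tsum n
        _ ≤ _ := le_mul_of_one_le_left' le_add_self
    · push Not at hbig
      have hle : ∑' n, {n | (W n ∩ U j).Nonempty}.indicator
          (fun n => ENNReal.ofReal (ρ n ^ t)) n ≤
          ∑' n, ENNReal.ofReal (ρ n ^ (t - d)) * volume (W n ∩ B) := by
        refine ENNReal.tsum_le_tsum fun n => ?_
        by_cases hn : (W n ∩ U j).Nonempty
        · rw [indicator_of_mem (show n ∈ {n | (W n ∩ U j).Nonempty} from hn)]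
          have hρr := hbig n hn
          obtain ⟨p, hpW, hpU⟩ := hn
          have hWB : W n ⊆ B := fun z hz => by
            have h2 := hUy hpU
            rw [hW, mem_ball] at hz hpW
            rw [mem_ball] at h2
            rw [hB, mem_closedBall]
            linarith [dist_triangle z p y, dist_triangle_right z p (w n)]
          rw [inter_eq_left.2 hWB, hW, volume_torus_ball_of_le_half _ (hρ n) (by linarith),
            ← ENNReal.ofReal_mul (Real.rpow_nonneg (hρ n).le _), hweight]
          refine ENNReal.ofReal_le_ofReal ?_
          exact le_mul_of_one_le_left (Real.rpow_nonneg (hρ n).le _) (one_le_pow₀ (by norm_num))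
        · rw [indicator_of_notMem (show n ∉ {n | (W n ∩ U j).Nonempty} from hn)]
          exact zero_le
      calc ENNReal.ofReal (r j ^ d) ≤ volume (ball (x j) (r j)) := by
            rw [volume_torus_ball_of_le_half _ hr0 hr3.le]
            gcongr
            linarith
        _ ≤ C * ENNReal.ofReal (singularValueFunction (a j) t) := h.volume_ball_le j
        _ ≤ C * (C₁ * _) := by
            gcongr
            exact (h.isRectangle j).singularValueFunction_le_tsum h.dim_pos h.exponent_pos
              h.exponent_le hρ hnull
        _ ≤ C * (C₁ * ∑' n, ENNReal.ofReal (ρ n ^ (t - d)) * volume (W n ∩ B)) := by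
            gcongr
        _ ≤ _ := by
            rw [← mul_assoc]
            gcongr
            exact le_self_add
  have hBvol : volume B ≤ L * ∫⁻ z in B, f z := by
    calc volume B ≤ ENNReal.ofReal (8 ^ d) * ENNReal.ofReal (r j ^ d) := by
          rw [← ENNReal.ofReal_mul (by positivity), ← mul_pow]
          refine (volume_torus_closedBall_le y (by linarith)).trans (le_of_eq ?_)
          congr 2
          ring
      _ ≤ _ := by
          rw [hL, mul_assoc]
          gcongr
  have hBlt : (∫⁻ z in B, f z) / volume B < L⁻¹ :=
    hR (show 4 * r j ∈ Set.Ioo 0 R₀ from ⟨by linarith, by linarith⟩)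
  have hB0 : volume B ≠ 0 := (measure_closedBall_pos volume y (by linarith)).ne'
  refine absurd hBlt (not_lt.2 ?_)
  rw [ENNReal.le_div_iff_mul_le (Or.inl hB0) (Or.inl (measure_ne_top _ _))]
  exact (ENNReal.inv_mul_le_iff hL0 hLtop).2 hBvol

/-- The limsup set is not covered, inside an open set `O`, by balls with finite `t`-cost that do
not exhaust the measure of `O`. -/
theorem IsTransferenceSystem.exists_mem_limsup_notMem (h : IsTransferenceSystem x r U a t C)
    (hρ : ∀ n, 0 < ρ n) (hρ1 : ∀ n, ρ n ≤ 1) (hsum : ∑' n, ENNReal.ofReal (ρ n ^ t) ≠ ⊤)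
    (hO : IsOpen O) (hpos : volume (O \ ⋃ n, ball (w n) (ρ n)) ≠ 0) :
    ∃ p ∈ (⋂ k, ⋃ j, ⋃ (_ : k ≤ j), U j), p ∈ O ∧ p ∉ ⋃ n, ball (w n) (ρ n) := by
  set W := ⋃ n, ball (w n) (ρ n) with hW
  have hWo : IsOpen W := isOpen_iUnion fun n => isOpen_ball
  set μ : Measure (Torus d) := volume.restrict (O \ W) with hμ
  have hVo : ∀ k, IsOpen (⋃ j, ⋃ (_ : k ≤ j), U j) := fun k =>
    isOpen_iUnion fun j => isOpen_iUnion fun _ => (h.isRectangle j).isOpen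
  have : CompactSpace μ.support := isCompact_iff_compactSpace.1 Measure.isClosed_support.isCompact
  have hdense : Dense (⋂ k, ((↑) : μ.support → Torus d) ⁻¹' ⋃ j, ⋃ (_ : k ≤ j), U j) := by
    refine dense_iInter_of_isOpen (fun k => (hVo k).preimage continuous_subtype_val) fun k => ?_
    rw [dense_iff_inter_open]
    rintro _ ⟨O', hO', rfl⟩ ⟨z, hz⟩
    have hzO' : 0 < μ O' := Measure.mem_support_iff_forall _ |>.1 z.2 O' (hO'.mem_nhds hz)
    have heq : O' ∩ (O \ W) = (O' ∩ O) \ W := by rw [inter_sdiff_assoc]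
    rw [hμ, Measure.restrict_apply hO'.measurableSet, heq] at hzO'
    have hne := h.volume_tail_inter_ne_zero hρ hρ1 hsum (hO'.inter hO) hzO'.ne' k
    rw [← hW, ← heq, ← inter_assoc, ← Measure.restrict_apply
      ((hVo k).inter hO').measurableSet] at hne
    obtain ⟨p, ⟨hpV, hpO'⟩, hpK⟩ := Measure.nonempty_inter_support_of_pos (pos_iff_ne_zero.2 hne)
    exact ⟨⟨p, hpK⟩, hpO', hpV⟩
  have hOpos : 0 < μ O := by
    rw [hμ, Measure.restrict_apply hO.measurableSet, inter_eq_right.2 diff_subset]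
    exact pos_iff_ne_zero.2 hpos
  obtain ⟨z, hzO, hzK⟩ := Measure.nonempty_inter_support_of_pos hOpos
  obtain ⟨p, hpO, hp⟩ := hdense.inter_open_nonempty (((↑) : μ.support → Torus d) ⁻¹' O)
    (hO.preimage continuous_subtype_val) ⟨⟨z, hzK⟩, hzO⟩
  refine ⟨p, mem_iInter.2 fun k => mem_iInter.1 hp k, hpO, fun hpW => ?_⟩
  refine Measure.subset_compl_support_of_isOpen hWo ?_ hpW p.2
  rw [hμ, Measure.restrict_apply hWo.measurableSet, inter_sdiff_self, measure_empty]

end LimsupSets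

section DyadicContent

variable {d : ℕ}

/-- A dyadic cube of diameter `δ` contains an open ball of radius `δ / 2`, and it lies in the
closed ball with the same centre and radius unless it has the maximal diameter `1 / 2`. -/
theorem IsDyadicCube.exists_center (hd : 0 < d) {D : Set (Torus d)} (hD : IsDyadicCube D) :
    ∃ (y : Torus d) (δ : ℝ), 0 < δ ∧ δ ≤ 1 / 2 ∧ Metric.ediam D = ENNReal.ofReal δ ∧
      ball y (δ / 2) ⊆ D ∧ (δ < 1 / 2 → D ⊆ closedBall y (δ / 2)) := by
  obtain ⟨n, k, rfl⟩ := hD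
  set σ : ℝ := 1 / 2 ^ n with hσ
  have hσ0 : 0 < σ := by positivity
  set D := torusProj '' (Set.univ.pi fun i => Set.Ico ((k i : ℝ) / 2 ^ n) (((k i : ℝ) + 1) / 2 ^ n))
  have hk : ∀ i, ((k i : ℝ) + 1) / 2 ^ n = (k i : ℝ) / 2 ^ n + σ := fun i => by rw [hσ]; ring
  set y : Torus d := torusProj fun i => (k i : ℝ) / 2 ^ n + σ / 2 with hy
  set δ := min σ (1 / 2) with hδ
  have hδ0 : 0 < δ := lt_min hσ0 (by norm_num)
  have hball : ball y (δ / 2) ⊆ D := by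
    intro q hq
    choose u hu hu' using fun i => exists_lift_dist (q i) (y i)
    refine ⟨fun i => (k i : ℝ) / 2 ^ n + σ / 2 + u i, fun i _ => ?_, ?_⟩
    · have h1 : |u i| < δ / 2 := (hu i).trans_lt ((dist_le_pi_dist q y i).trans_lt hq)
      have h2 := abs_lt.1 (h1.trans_le (by gcongr; exact min_le_left _ _ : δ / 2 ≤ σ / 2))
      beta_reduce
      rw [hk]
      constructor <;> linarith [h2.1, h2.2]
    · funext i
      rw [torusProj, AddCircle.coe_add, hu' i, hy, torusProj]
      abel
  have hclosed : D ⊆ closedBall y (σ / 2) := by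
    rintro _ ⟨z, hz, rfl⟩
    rw [mem_closedBall, dist_pi_le_iff (by positivity)]
    intro i
    have hzi := hz i trivial
    beta_reduce at hzi
    rw [hk] at hzi
    rw [dist_eq_norm, hy, torusProj, torusProj, ← AddCircle.coe_sub]
    refine (norm_coe_le_abs _).trans ?_
    rw [abs_le]
    constructor <;> linarith [hzi.1, hzi.2]
  have hdiam : Metric.ediam D = ENNReal.ofReal δ := by
    refine le_antisymm (Metric.ediam_le fun p hp q hq => ?_) ?_
    · rw [edist_dist]
      refine ENNReal.ofReal_le_ofReal (le_min ?_ ?_)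
      · have h1 := hclosed hp
        have h2 := hclosed hq
        rw [mem_closedBall] at h1 h2
        linarith [dist_triangle_right p q y]
      · rw [dist_pi_le_iff (by norm_num)]
        intro i
        rw [dist_eq_norm]
        simpa using AddCircle.norm_le_half_period (1 : ℝ) (x := p i - q i) one_ne_zero
    · refine le_of_forall_lt fun b hb => ?_
      obtain ⟨θ, hθ, rfl⟩ : ∃ θ : ℝ, 0 ≤ θ ∧ ENNReal.ofReal θ = b :=
        ⟨b.toReal, ENNReal.toReal_nonneg, ENNReal.ofReal_toReal hb.ne_top⟩
      have hθδ : θ < δ := (ENNReal.ofReal_lt_ofReal_iff hδ0).1 hb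
      set θ' := (θ + δ) / 2
      have hmem : ∀ τ : ℝ, 0 ≤ τ → τ < δ → torusProj (fun i => (k i : ℝ) / 2 ^ n + τ) ∈ D :=
        fun τ h0 h1 => mem_image_of_mem _ fun i _ => by
          beta_reduce
          rw [hk]
          constructor <;> linarith [min_le_left σ (1 / 2)]
      refine lt_of_lt_of_le ?_ (Metric.edist_le_ediam_of_mem
        (hmem θ' (by positivity) (by simp only [θ']; linarith)) (hmem 0 le_rfl hδ0))
      rw [edist_dist, ENNReal.ofReal_lt_ofReal_iff_of_nonneg hθ]
      refine lt_of_lt_of_le (b := θ') (by simp only [θ']; linarith) ?_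
      refine le_trans (le_of_eq ?_) (dist_le_pi_dist _ _ ⟨0, hd⟩)
      have hθ' : |θ'| = θ' := abs_of_nonneg (by positivity)
      rw [dist_eq_norm, torusProj, torusProj, ← AddCircle.coe_sub, add_sub_add_left_eq_sub,
        sub_zero, (AddCircle.norm_coe_eq_abs_iff (1 : ℝ) one_ne_zero).2, hθ']
      rw [hθ', abs_one]
      simp only [θ']
      linarith [min_le_right σ (1 / 2)]
  refine ⟨y, δ, hδ0, min_le_right _ _, hdiam, hball, fun h => ?_⟩
  have : δ = σ := by
    rcases min_choice σ (1 / 2) with h' | h'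
    · exact h'
    · exact absurd h (by rw [hδ, h']; exact lt_irrefl _)
  rw [this]
  exact hclosed

theorem dyadicContent_eq_top (hd : 0 < d) {u : ℝ} (hu : u ≤ 0) (E : Set (Torus d)) :
    dyadicContent u E = ⊤ := by
  refine iInf_eq_top.2 fun f => iInf_eq_top.2 fun hf => iInf_eq_top.2 fun _ => ?_
  refine top_le_iff.1 (le_of_eq_of_le
    (ENNReal.tsum_const_eq_top_of_ne_zero (α := ℕ) one_ne_zero).symm ?_)
  refine ENNReal.tsum_le_tsum fun n => ?_
  obtain ⟨y, δ, hδ, hδ', hdiam, -⟩ := (hf n).exists_center hd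
  change 1 ≤ Metric.ediam (f n) ^ u
  rw [hdiam, ENNReal.ofReal_rpow_of_pos hδ, ENNReal.one_le_ofReal]
  exact Real.one_le_rpow_of_pos_of_le_one_of_nonpos hδ (by linarith) hu

variable {x : ℕ → Torus d} {r : ℕ → ℝ} {U : ℕ → Set (Torus d)} {a : ℕ → Fin d → ℝ} {t : ℝ}
  {C : ℝ≥0∞}

theorem volume_diff_iUnion_ball_ne_zero {O : Set (Torus d)} {w : ℕ → Torus d} {ρ : ℕ → ℝ}
    (hρ : ∀ n, 0 < ρ n) (h : ∑' n, ENNReal.ofReal ((2 * ρ n) ^ d) < volume O) :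
    volume (O \ ⋃ n, ball (w n) (ρ n)) ≠ 0 := by
  intro h0
  refine absurd h (not_lt.2 ?_)
  calc volume O ≤ volume (O ∩ ⋃ n, ball (w n) (ρ n)) + volume (O \ ⋃ n, ball (w n) (ρ n)) :=
        measure_le_inter_add_sdiff _ _ _
    _ ≤ volume (⋃ n, ball (w n) (ρ n)) := by
        rw [h0, add_zero]
        exact measure_mono inter_subset_right
    _ ≤ ∑' n, volume (ball (w n) (ρ n)) := measure_iUnion_le _
    _ ≤ _ := ENNReal.tsum_le_tsum fun n => volume_torus_ball_le _ (hρ n)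

theorem IsTransferenceSystem.ediam_rpow_le_dyadicContent (h : IsTransferenceSystem x r U a t C)
    {u : ℝ} (hu : 0 < u) (hut : u ≤ t) {D : Set (Torus d)} (hD : IsDyadicCube D) :
    Metric.ediam D ^ u ≤ dyadicContent u ((⋂ k, ⋃ j, ⋃ (_ : k ≤ j), U j) ∩ D) := by
  refine le_iInf fun f => le_iInf fun hf => le_iInf fun hcov => ?_
  change _ ≤ ∑' n, Metric.ediam (f n) ^ u
  by_contra! hlt
  obtain ⟨y, δ, hδ, hδ', hdiam, hball, -⟩ := hD.exists_center h.dim_pos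
  choose w e he he' hediam _ hclosed using fun n => (hf n).exists_center h.dim_pos
  have hud : u ≤ d := hut.trans h.exponent_le
  have hterm : ∀ n, Metric.ediam (f n) ^ u = ENNReal.ofReal (e n ^ u) := fun n => by
    rw [hediam, ENNReal.ofReal_rpow_of_pos (he n)]
  simp_rw [hterm] at hlt
  rw [hdiam, ENNReal.ofReal_rpow_of_pos hδ] at hlt
  have heδ : ∀ n, e n < δ := fun n => by
    have h1 := (ENNReal.le_tsum n).trans_lt hlt
    rw [ENNReal.ofReal_lt_ofReal_iff (by positivity)] at h1
    exact (Real.rpow_lt_rpow_iff (he n).le hδ.le hu).1 h1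
  have hvol : ∑' n, ENNReal.ofReal (e n ^ d) < ENNReal.ofReal (δ ^ d) := by
    have hsplit : ∀ v : ℝ, 0 < v → v ^ d = v ^ (d - u) * v ^ u := fun v hv => by
      rw [← Real.rpow_add hv, sub_add_cancel, Real.rpow_natCast]
    calc ∑' n, ENNReal.ofReal (e n ^ d)
        ≤ ∑' n, ENNReal.ofReal (δ ^ (d - u)) * ENNReal.ofReal (e n ^ u) := by
          refine ENNReal.tsum_le_tsum fun n => ?_
          rw [← ENNReal.ofReal_mul (by positivity), hsplit _ (he n)]
          refine ENNReal.ofReal_le_ofReal (mul_le_mul_of_nonneg_right ?_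
            (Real.rpow_nonneg (he n).le _))
          exact Real.rpow_le_rpow (he n).le (heδ n).le (by linarith)
      _ = ENNReal.ofReal (δ ^ (d - u)) * ∑' n, ENNReal.ofReal (e n ^ u) := ENNReal.tsum_mul_left
      _ < ENNReal.ofReal (δ ^ (d - u)) * ENNReal.ofReal (δ ^ u) := by
          refine ENNReal.mul_lt_mul_right ?_ ENNReal.ofReal_ne_top hlt
          simpa using Real.rpow_pos_of_pos hδ _
      _ = _ := by rw [← ENNReal.ofReal_mul (by positivity), ← hsplit _ hδ]
  obtain ⟨c, ⟨hc1, hc2⟩, hc⟩ : ∃ c : ℝ, c ∈ Set.Ioc 1 2 ∧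
      ENNReal.ofReal (c ^ d) * ∑' n, ENNReal.ofReal (e n ^ d) < ENNReal.ofReal (δ ^ d) := by
    have hcont : Tendsto (fun c : ℝ => ENNReal.ofReal (c ^ d) * ∑' n, ENNReal.ofReal (e n ^ d))
        (𝓝[>] 1) (𝓝 (ENNReal.ofReal (1 ^ d) * ∑' n, ENNReal.ofReal (e n ^ d))) := by
      refine ENNReal.Tendsto.mul_const ?_ (Or.inr hvol.ne_top)
      exact (ENNReal.continuous_ofReal.comp (continuous_pow d)).continuousAt.mono_left
        nhdsWithin_le_nhds
    have hev := hcont.eventually_lt_const (by simpa using hvol)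
    obtain ⟨c, hc, hc'⟩ := (hev.and (Ioc_mem_nhdsGT (one_lt_two : (1 : ℝ) < 2))).exists
    exact ⟨c, hc', hc⟩
  set ρ : ℕ → ℝ := fun n => c * e n / 2 with hρdef
  have hρ : ∀ n, 0 < ρ n := fun n => by have := he n; simp only [hρdef]; positivity
  have hρe : ∀ n, ρ n ≤ e n := fun n => by simp only [hρdef]; nlinarith [he n]
  have hsum : ∑' n, ENNReal.ofReal (ρ n ^ t) ≠ ⊤ := by
    refine ne_top_of_le_ne_top hlt.ne_top (ENNReal.tsum_le_tsum fun n => ?_)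
    refine ENNReal.ofReal_le_ofReal ?_
    calc ρ n ^ t ≤ e n ^ t := Real.rpow_le_rpow (hρ n).le (hρe n) h.exponent_pos.le
      _ ≤ e n ^ u := Real.rpow_le_rpow_of_exponent_ge (he n) (by linarith [he' n]) hut
  have hpos : volume (ball y (δ / 2) \ ⋃ n, ball (w n) (ρ n)) ≠ 0 := by
    refine volume_diff_iUnion_ball_ne_zero hρ ?_
    rw [volume_torus_ball_of_le_half y (by linarith) (by linarith),
      mul_div_cancel₀ _ (two_ne_zero' ℝ)]
    refine lt_of_le_of_lt (le_of_eq ?_) hc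
    rw [← ENNReal.tsum_mul_left]
    refine tsum_congr fun n => ?_
    rw [← ENNReal.ofReal_mul (by positivity), ← mul_pow, hρdef,
      mul_div_cancel₀ _ (two_ne_zero' ℝ)]
  obtain ⟨p, hpE, hpO, hpW⟩ := h.exists_mem_limsup_notMem hρ
    (fun n => by linarith [hρe n, he' n]) hsum isOpen_ball hpos
  obtain ⟨n, hn⟩ := mem_iUnion.1 (hcov ⟨hpE, hball hpO⟩)
  refine hpW (mem_iUnion.2 ⟨n, ?_⟩)
  refine closedBall_subset_ball ?_ (hclosed n ((heδ n).trans_le hδ') hn)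
  simp only [hρdef]
  nlinarith [he n]

theorem IsTransferenceSystem.le_dimH (h : IsTransferenceSystem x r U a t C) :
    ENNReal.ofReal t ≤ dimH (⋂ k, ⋃ j, ⋃ (_ : k ≤ j), U j) := by
  set E := ⋂ k, ⋃ j, ⋃ (_ : k ≤ j), U j with hE
  have ht := h.exponent_pos
  refine le_dimH_of_hausdorffMeasure_ne_zero (d := t.toNNReal) ?_
  rw [Real.coe_toNNReal t ht.le]
  intro h0
  rw [Measure.hausdorffMeasure_apply] at h0
  set η : ℝ := 1 / (2 * 2 ^ d * 2 ^ t) with hη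
  have hη0 : 0 < η := by positivity
  have hη0' : 0 < ENNReal.ofReal η := by simpa using hη0
  have h1 := (le_iSup₂ (f := fun (q : ℝ≥0∞) (_ : 0 < q) => ⨅ S : ℕ → Set (Torus d),
    ⨅ (_ : E ⊆ ⋃ n, S n), ⨅ (_ : ∀ n, Metric.ediam (S n) ≤ q),
      ∑' n, ⨆ (_ : (S n).Nonempty), Metric.ediam (S n) ^ t)
    (ENNReal.ofReal (1 / 16)) (by simp)).trans_lt (h0.trans_lt hη0')
  simp only [iInf_lt_iff] at h1
  obtain ⟨S, hcov, hS, hSsum⟩ := h1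
  obtain ⟨ε, hε, hεsum⟩ := ENNReal.exists_pos_sum_of_countable hη0'.ne' ℕ
  set δ : ℕ → ℝ := fun n => (Metric.ediam (S n)).toReal with hδ
  have hStop : ∀ n, Metric.ediam (S n) ≠ ⊤ := fun n =>
    ne_top_of_le_ne_top ENNReal.ofReal_ne_top (hS n)
  have hδ0 : ∀ n, 0 ≤ δ n := fun n => ENNReal.toReal_nonneg
  have hδ16 : ∀ n, δ n ≤ 1 / 16 := fun n =>
    ENNReal.toReal_le_of_le_ofReal (by norm_num) (hS n)
  set e : ℕ → ℝ := fun n => min ((ε n : ℝ) ^ t⁻¹) (1 / 16) with he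
  have he0 : ∀ n, 0 < e n := fun n =>
    lt_min (Real.rpow_pos_of_pos (by exact_mod_cast hε n) _) (by norm_num)
  have het : ∀ n, e n ^ t ≤ ε n := fun n => by
    calc e n ^ t ≤ ((ε n : ℝ) ^ t⁻¹) ^ t :=
          Real.rpow_le_rpow (he0 n).le (min_le_left _ _) ht.le
      _ = ε n := by rw [← Real.rpow_mul (NNReal.coe_nonneg _), inv_mul_cancel₀ ht.ne',
          Real.rpow_one]
  set ρ : ℕ → ℝ := fun n => 2 * max (δ n) (e n) with hρdef
  have hmax : ∀ n, 0 < max (δ n) (e n) := fun n => lt_max_of_lt_right (he0 n)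
  have hρ : ∀ n, 0 < ρ n := fun n => mul_pos two_pos (hmax n)
  have hρ8 : ∀ n, ρ n ≤ 1 := fun n => by
    have : max (δ n) (e n) ≤ 1 / 16 := max_le (hδ16 n) (min_le_right _ _)
    simp only [hρdef]
    linarith
  have hcost : ∀ n, ENNReal.ofReal (ρ n ^ t) ≤ ENNReal.ofReal (2 ^ t) *
      ((⨆ (_ : (S n).Nonempty), Metric.ediam (S n) ^ t) + ε n) := fun n => by
    have h2 : ENNReal.ofReal (δ n ^ t) ≤ ⨆ (_ : (S n).Nonempty), Metric.ediam (S n) ^ t := by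
      rcases (S n).eq_empty_or_nonempty with hn | hn
      · have : δ n = 0 := by simp [hδ, hn]
        rw [this, Real.zero_rpow ht.ne', ENNReal.ofReal_zero]
        exact zero_le
      · rw [ciSup_pos hn, ← ENNReal.ofReal_rpow_of_nonneg (hδ0 n) ht.le, hδ,
          ENNReal.ofReal_toReal (hStop n)]
    have h3 : ρ n ^ t ≤ 2 ^ t * (δ n ^ t + ε n) := by
      simp only [hρdef]
      rw [Real.mul_rpow two_pos.le (hmax n).le]
      gcongr
      rcases max_choice (δ n) (e n) with h' | h' <;> rw [h']
      · linarith [NNReal.coe_nonneg (ε n)]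
      · linarith [het n, Real.rpow_nonneg (hδ0 n) t]
    refine (ENNReal.ofReal_le_ofReal h3).trans ?_
    rw [ENNReal.ofReal_mul (by positivity), ENNReal.ofReal_add (Real.rpow_nonneg (hδ0 n) _)
      (NNReal.coe_nonneg _), ENNReal.ofReal_coe_nnreal]
    gcongr
  have htot : ∑' n, ENNReal.ofReal (ρ n ^ t) < ENNReal.ofReal (2 ^ t * (2 * η)) := by
    refine (ENNReal.tsum_le_tsum hcost).trans_lt ?_
    rw [ENNReal.tsum_mul_left, ENNReal.tsum_add, ENNReal.ofReal_mul (by positivity), two_mul,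
      ENNReal.ofReal_add hη0.le hη0.le]
    refine ENNReal.mul_lt_mul_right ?_ ENNReal.ofReal_ne_top (ENNReal.add_lt_add hSsum hεsum)
    simpa using Real.rpow_pos_of_pos two_pos t
  have hpos : ∀ w : ℕ → Torus d, volume (Set.univ \ ⋃ n, ball (w n) (ρ n)) ≠ 0 := fun w => by
    refine volume_diff_iUnion_ball_ne_zero hρ ?_
    calc ∑' n, ENNReal.ofReal ((2 * ρ n) ^ d)
        ≤ ∑' n, ENNReal.ofReal (2 ^ d) * ENNReal.ofReal (ρ n ^ t) := by
          refine ENNReal.tsum_le_tsum fun n => ?_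
          rw [← ENNReal.ofReal_mul (by positivity), mul_pow]
          refine ENNReal.ofReal_le_ofReal ?_
          gcongr
          rw [← Real.rpow_natCast]
          exact Real.rpow_le_rpow_of_exponent_ge (hρ n) (hρ8 n) h.exponent_le
      _ < ENNReal.ofReal (2 ^ d) * ENNReal.ofReal (2 ^ t * (2 * η)) := by
          rw [ENNReal.tsum_mul_left]
          exact ENNReal.mul_lt_mul_right (by simp) ENNReal.ofReal_ne_top htot
      _ = 1 := by
          rw [← ENNReal.ofReal_mul (by positivity), ← ENNReal.ofReal_one, hη]
          congr 1
          field_simp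
      _ = volume (Set.univ : Set (Torus d)) := by
          rw [← Set.pi_univ Set.univ, volume_pi_pi]
          simp
  classical
  set w : ℕ → Torus d := fun n => if hn : (S n).Nonempty then hn.some else 0 with hw
  obtain ⟨p, hpE, -, hpW⟩ := h.exists_mem_limsup_notMem hρ hρ8
    (ne_top_of_le_ne_top ENNReal.ofReal_ne_top htot.le) isOpen_univ (hpos w)
  obtain ⟨n, hn⟩ := mem_iUnion.1 (hcov hpE)
  have hne : (S n).Nonempty := ⟨p, hn⟩
  refine hpW (mem_iUnion.2 ⟨n, ?_⟩)
  have hwn : w n ∈ S n := by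
    simp only [hw, dif_pos hne]
    exact hne.some_mem
  have hdist : dist p (w n) ≤ δ n := by
    rw [dist_edist]
    exact ENNReal.toReal_mono (hStop n) (Metric.edist_le_ediam_of_mem hn hwn)
  rw [mem_ball]
  simp only [hρdef]
  linarith [le_max_left (δ n) (e n), hmax n]

end DyadicContent

/-- **Corollary (mass transference for rectangles).** If `limsup B(x_j,r_j)` has full
measure, the `U_j ⊆ B(x_j,r_j)` are open (possibly rotated) rectangles, and
`s = sup{ t ∈ (0,d] : sup_j λ(B(x_j,r_j)) / φ^t(U_j) < ∞ }`, then
`dim_H (limsup U_j) ≥ s` and `limsup U_j ∈ 𝒢^s(𝕋^d)`. -/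
theorem mass_transference_rectangles
    (d : ℕ) (hd : 0 < d)
    (x : ℕ → Torus d) (r : ℕ → ℝ) (hr : ∀ j, 0 < r j)
    (hrlim : Tendsto r atTop (𝓝 0))
    (hfull : volume ((⋂ k, ⋃ j, ⋃ (_ : k ≤ j), ball (x j) (r j))ᶜ) = 0)
    (U : ℕ → Set (Torus d)) (a : ℕ → Fin d → ℝ)
    (hrect : ∀ j, IsRectangleWithSides (U j) (a j))
    (hUB : ∀ j, U j ⊆ ball (x j) (r j))
    (s : ℝ)
    (hs : s = sSup {t : ℝ | 0 < t ∧ t ≤ d ∧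
      (⨆ j, volume (ball (x j) (r j)) /
        ENNReal.ofReal (singularValueFunction (a j) t)) < ⊤}) :
    ENNReal.ofReal s ≤ dimH (⋂ k, ⋃ j, ⋃ (_ : k ≤ j), U j) ∧
      MemLargeIntersectionClass s (⋂ k, ⋃ j, ⋃ (_ : k ≤ j), U j) := by
  have hfull' : ∀ᵐ y : Torus d, y ∈ ⋂ k, ⋃ j, ⋃ (_ : k ≤ j), ball (x j) (r j) := hfull
  set T : Set ℝ := {t : ℝ | 0 < t ∧ t ≤ d ∧
    (⨆ j, volume (ball (x j) (r j)) / ENNReal.ofReal (singularValueFunction (a j) t)) < ⊤} with hT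
  have hsys : ∀ t ∈ T, IsTransferenceSystem x r U a t
      (⨆ j, volume (ball (x j) (r j)) / ENNReal.ofReal (singularValueFunction (a j) t)) :=
    fun t ht => ⟨hd, hr, hrlim, hfull', hrect, hUB, ht.1, ht.2.1, ht.2.2.ne, fun j => by
      have hφ := singularValueFunction_pos (hrect j).1 t
      rw [← ENNReal.div_le_iff_le_mul (Or.inl (by simpa using hφ)) (Or.inl ENNReal.ofReal_ne_top)]
      exact le_iSup (fun j => volume (ball (x j) (r j)) /
        ENNReal.ofReal (singularValueFunction (a j) t)) j⟩
  have hlt : ∀ u, 0 ≤ u → u < s → ∃ t ∈ T, u < t := fun u hu hus => by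
    rw [hs] at hus
    refine exists_lt_of_lt_csSup (nonempty_iff_ne_empty.2 fun hTe => ?_) hus
    rw [hTe, Real.sSup_empty] at hus
    exact absurd hus (not_lt.2 hu)
  refine ⟨?_, ?_, fun D hD u hus => ?_⟩
  · by_contra! hdim
    have hfin := hdim.ne_top
    obtain ⟨t, htT, ht⟩ := hlt _ ENNReal.toReal_nonneg ((ENNReal.lt_ofReal_iff_toReal_lt hfin).1 hdim)
    exact absurd ((hsys t htT).le_dimH) (not_le.2 ((ENNReal.lt_ofReal_iff_toReal_lt hfin).2 ht))
  · exact IsGδ.iInter_of_isOpen fun k => isOpen_iUnion fun j => isOpen_iUnion fun _ =>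
      (hrect j).isOpen
  · rcases le_or_gt u 0 with hu | hu
    · rw [dyadicContent_eq_top hd hu]
      exact le_top
    · obtain ⟨t, htT, ht⟩ := hlt u hu.le hus
      exact (hsys t htT).ediam_rpow_le_dyadicContent hu ht.le hD
end
end
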